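/- arXiv:1001.2792 — 4 statements merged into one kernel-verified Lean document; each statement's English description precedes it below -/
import Mathlib

section
/- Let P ⊂ ℝ^n be an n-dimensional simple lattice polytope of degree d with d < n. If d ≥ n − d, then Σ_{j=0}^{n} (−1)^j Σ_{F ∈ F(P)_j} ( (n−d)·h*_{n−d}(F) + (j+1)·Σ_{k=0}^{n−d−1} h*_k(F) ) = 0. -/
open scoped Pointwise
open MeasureTheory

noncomputable section

/-- The image of an integer point under the coercion `ℤ → ℝ` (a lattice point). -/
def latt {ι : Type*} (x : ι → ℤ) : ι → ℝ := fun i => (x i : ℝ)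

/-- A lattice polytope: the convex hull of finitely many points of `ℤ^ι`. -/
def IsLatticePolytope {ι : Type*} (P : Set (ι → ℝ)) : Prop :=
  ∃ V : Finset (ι → ℤ), P = convexHull ℝ (latt '' (V : Set (ι → ℤ)))

/-- The codegree: the smallest positive integer `k` such that the (relative) interior
of the dilate `kP` contains a lattice point. -/
def cd {ι : Type*} (P : Set (ι → ℝ)) : ℕ :=
  sInf {k : ℕ | 1 ≤ k ∧ ∃ x : ι → ℤ, latt x ∈ intrinsicInterior ℝ ((k : ℝ) • P)}

/-- `F` is a (nonempty, exposed) face of `P` of dimension `j`. -/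
def IsFaceOfDim {n : ℕ} (P F : Set (Fin n → ℝ)) (j : ℕ) : Prop :=
  F.Nonempty ∧ IsExposed ℝ P F ∧ Module.finrank ℝ (affineSpan ℝ F).direction = j

/-- A polytope is simple if every vertex (0-dimensional face) is contained in
exactly `n` facets ((n-1)-dimensional faces). -/
def IsSimplePolytope {n : ℕ} (P : Set (Fin n → ℝ)) : Prop :=
  ∀ F0, IsFaceOfDim P F0 0 → {F | IsFaceOfDim P F (n - 1) ∧ F0 ⊆ F}.ncard = n

/-- The number of lattice points of the dilate `mF`. -/
def lattCount {n : ℕ} (F : Set (Fin n → ℝ)) (m : ℕ) : ℕ :=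
  Set.ncard {x : Fin n → ℤ | latt x ∈ (m : ℝ) • F}

/-- `h` is the collection of `h^*`-coefficients of the `j`-dimensional lattice polytope `F`:
`h k = 0` for `k > j`, and the Ehrhart counting function of `F` satisfies
`|mF ∩ ℤ^n| = ∑_{k=0}^{j} h k * C(m + j - k, j)` for all `m ∈ ℕ`. -/
def IsHStarOfDim {n : ℕ} (F : Set (Fin n → ℝ)) (j : ℕ) (h : ℕ → ℤ) : Prop :=
  (∀ i, j < i → h i = 0) ∧
    ∀ m : ℕ, (lattCount F m : ℤ) =
      ∑ i ∈ Finset.range (j + 1), h i * ((m + j - i).choose j)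

open PowerSeries in
theorem hstar_series_mul_one_sub_pow {j : ℕ} {h L : ℕ → ℤ} (hh : ∀ i, j < i → h i = 0)
    (hL : ∀ m, L m = ∑ i ∈ Finset.range (j + 1), h i * ((m + j - i).choose j)) :
    (PowerSeries.mk L) * (1 - X) ^ (j + 1) = PowerSeries.mk h := by
  have key : PowerSeries.mk L = PowerSeries.mk h * (invOneSubPow ℤ (j + 1)).val := by
    ext m
    rw [invOneSubPow_val_succ_eq_mk_add_choose, coeff_mul, coeff_mk, hL,
      Finset.Nat.sum_antidiagonal_eq_sum_range_succ_mk]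
    have h1 : ∑ i ∈ Finset.range (j + 1), h i * (((m + j - i).choose j : ℕ) : ℤ) =
        ∑ i ∈ Finset.range (m + j + 1), h i * (((m + j - i).choose j : ℕ) : ℤ) := by
      refine Finset.sum_subset (Finset.range_mono (by omega)) fun i _ hi => ?_
      rw [hh i (by simpa using hi), zero_mul]
    have h2 : ∑ i ∈ Finset.range (m + 1), h i * (((m + j - i).choose j : ℕ) : ℤ) =
        ∑ i ∈ Finset.range (m + j + 1), h i * (((m + j - i).choose j : ℕ) : ℤ) := by
      refine Finset.sum_subset (Finset.range_mono (by omega)) fun i _ hi => ?_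
      rw [Finset.mem_range] at hi
      rcases le_or_gt i j with hij | hij
      · rw [Nat.choose_eq_zero_of_lt (by omega), Nat.cast_zero, mul_zero]
      · rw [hh i hij, zero_mul]
    rw [h1, ← h2]
    refine Finset.sum_congr rfl fun i hi => ?_
    rw [Finset.mem_range] at hi
    rw [coeff_mk, coeff_mk, show j + (m - i) = m + j - i by omega]
  rw [key, mul_assoc, ← invOneSubPow_inv_eq_one_sub_pow, Units.inv_eq_val_inv, Units.mul_inv, mul_one]

open PowerSeries in
theorem coeff_one_sub_X_pow (N k : ℕ) :
    coeff k ((1 - X : ℤ⟦X⟧) ^ N) = (-1) ^ k * (N.choose k : ℤ) := by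
  have : (1 - X : ℤ⟦X⟧) ^ N = (((1 - Polynomial.X) ^ N : Polynomial ℤ) : ℤ⟦X⟧) := by simp
  rw [this, Polynomial.coeff_coe]
  have h2 : ((1 - Polynomial.X) ^ N : Polynomial ℤ) =
      ((1 + Polynomial.X) ^ N : Polynomial ℤ).comp (Polynomial.C (-1) * Polynomial.X) := by
    simp [sub_eq_add_neg]
  rw [h2, Polynomial.comp_C_mul_X_coeff, Polynomial.coeff_one_add_X_pow, mul_comm]

open PowerSeries in
theorem hstar_weight_eq {j : ℕ} {h L : ℕ → ℤ} (hh : ∀ i, j < i → h i = 0)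
    (hL : ∀ m, L m = ∑ i ∈ Finset.range (j + 1), h i * ((m + j - i).choose j)) (c : ℕ) :
    (c : ℤ) * h c + ((j : ℤ) + 1) * ∑ k ∈ Finset.range c, h k =
      ∑ q ∈ Finset.HasAntidiagonal.antidiagonal c,
        (-1) ^ q.1 * ((j + 1).choose q.1 : ℤ) * ((q.2 : ℤ) * L q.2) := by
  have hA := hstar_series_mul_one_sub_pow hh hL
  have hB : PowerSeries.mk L * (1 - X) ^ j = PowerSeries.mk h * PowerSeries.mk 1 := by
    rw [← hA, pow_succ, mul_assoc, mul_assoc, mul_comm (1 - X) (PowerSeries.mk 1),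
      mk_one_mul_one_sub_eq_one, mul_one]
  have hD : X * d⁄dX ℤ (PowerSeries.mk L) * (1 - X) ^ (j + 1) =
      X * d⁄dX ℤ (PowerSeries.mk h) +
        ((j : ℤ⟦X⟧) + 1) * (X * (PowerSeries.mk h * PowerSeries.mk 1)) := by
    rw [← hB, ← hA, Derivation.leibniz, Derivation.leibniz_pow]
    simp only [map_sub, derivative_one, derivative_X, smul_eq_mul, Nat.add_sub_cancel,
      nsmul_eq_mul]
    push_cast
    ring
  have hX (f : ℕ → ℤ) (m : ℕ) : coeff m (X * d⁄dX ℤ (PowerSeries.mk f)) = m * f m := by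
    cases m with
    | zero => simp
    | succ m => rw [coeff_succ_X_mul, coeff_derivative, coeff_mk]; push_cast; ring
  have hS : coeff c (X * (PowerSeries.mk h * PowerSeries.mk (1 : ℕ → ℤ))) =
      ∑ k ∈ Finset.range c, h k := by
    cases c with
    | zero => simp
    | succ m =>
      rw [coeff_succ_X_mul, coeff_mul, Finset.Nat.sum_antidiagonal_eq_sum_range_succ_mk]
      simp
  have hC := congrArg (coeff c) hD
  rw [map_add, hX, mul_comm (X * _), coeff_mul,
    show ((j : ℤ⟦X⟧) + 1) = C ((j : ℤ) + 1) by simp, coeff_C_mul, hS] at hC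
  rw [← hC]
  refine Finset.sum_congr rfl fun q _ => ?_
  rw [hX, coeff_one_sub_X_pow]

theorem sum_powerset_neg_one_pow_mul_choose_eq_zero {α : Type*} [DecidableEq α] (A : Finset α)
    (N e : ℕ) (he : e < A.card) (hN : A.card ≤ N) :
    ∑ S ∈ A.powerset, (-1 : ℤ) ^ S.card * ((N - S.card).choose e : ℤ) = 0 := by
  induction A using Finset.induction_on generalizing N e with
  | empty => simp at he
  | insert a A ha ih =>
    rw [Finset.card_insert_of_notMem ha] at he hN
    rw [Finset.sum_powerset_insert ha, ← Finset.sum_add_distrib]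
    have hstep : ∀ S ∈ A.powerset, (-1 : ℤ) ^ S.card * ((N - S.card).choose e : ℤ) +
        (-1 : ℤ) ^ (insert a S).card * ((N - (insert a S).card).choose e : ℤ) =
        if e = 0 then 0 else (-1 : ℤ) ^ S.card * ((N - 1 - S.card).choose (e - 1) : ℤ) := by
      intro S hS
      rw [Finset.mem_powerset] at hS
      have hc := Finset.card_le_card hS
      rw [Finset.card_insert_of_notMem fun h => ha (hS h)]
      obtain ⟨M, hM⟩ : ∃ M, N - S.card = M + 1 := ⟨N - S.card - 1, by omega⟩
      rw [hM, show N - (S.card + 1) = M by omega, show N - 1 - S.card = M by omega]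
      cases e with
      | zero => simp [pow_succ]
      | succ e => simp [Nat.choose_succ_succ, pow_succ]; ring
    rw [Finset.sum_congr rfl hstep]
    split_ifs with h0
    · simp
    · exact ih (N - 1) (e - 1) (by omega) (by omega)

section HalfspacePresentation

variable {E : Type*} [NormedAddCommGroup E] [NormedSpace ℝ E]

/-- Moving along a direction in which some constraint increases, one reaches a point where all
constraints still hold and one of the increasing constraints is tight. -/
theorem exists_nonneg_forall_le_and_exists_eq {ι : Type*} (s : Finset ι) (α β c : ι → ℝ)
    (hα : ∀ i ∈ s, α i ≤ c i) (hβ : ∃ i ∈ s, 0 < β i) :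
    ∃ t : ℝ, 0 ≤ t ∧ (∀ i ∈ s, α i + t * β i ≤ c i) ∧
      ∃ i ∈ s, 0 < β i ∧ α i + t * β i = c i := by
  obtain ⟨i₀, hi₀, hβ₀⟩ := hβ
  obtain ⟨k, hk, hmin⟩ := (s.filter (0 < β ·)).exists_min_image (fun i => (c i - α i) / β i)
    ⟨i₀, Finset.mem_filter.2 ⟨hi₀, hβ₀⟩⟩
  rw [Finset.mem_filter] at hk
  have ht : 0 ≤ (c k - α k) / β k := div_nonneg (sub_nonneg.2 (hα k hk.1)) hk.2.le
  refine ⟨(c k - α k) / β k, ht, fun i hi => ?_, k, hk.1, hk.2, ?_⟩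
  · rcases le_or_gt (β i) 0 with h | h
    · linarith [hα i hi, mul_nonpos_of_nonneg_of_nonpos ht h]
    · have := hmin i (Finset.mem_filter.2 ⟨hi, h⟩)
      rw [le_div_iff₀ h] at this
      linarith
  · rw [div_mul_cancel₀ _ hk.2.ne']
    ring

/-- The constraints `l x ≤ b l`, `l ∈ Φ`, which are tight at `x`. -/
noncomputable def activeConstraints (Φ : Finset (StrongDual ℝ E)) (b : StrongDual ℝ E → ℝ) (x : E) :
    Finset (StrongDual ℝ E) :=
  Φ.filter fun l => l x = b l

theorem mem_activeConstraints {Φ : Finset (StrongDual ℝ E)} {b : StrongDual ℝ E → ℝ} {x : E}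
    {l : StrongDual ℝ E} : l ∈ activeConstraints Φ b x ↔ l ∈ Φ ∧ l x = b l :=
  Finset.mem_filter

/-- The part of `P` on which the constraints in `S` are tight. -/
def tightFace (P : Set E) (b : StrongDual ℝ E → ℝ) (S : Finset (StrongDual ℝ E)) : Set E :=
  {x | x ∈ P ∧ ∀ l ∈ S, l x = b l}

/-- `P` is bounded and cut out by the constraints `l x ≤ b l`, `l ∈ Φ`. -/
structure IsHalfspacePresentation (P : Set E) (Φ : Finset (StrongDual ℝ E))
    (b : StrongDual ℝ E → ℝ) : Prop where
  mem_iff : ∀ x, x ∈ P ↔ ∀ l ∈ Φ, l x ≤ b l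
  isBounded : Bornology.IsBounded P

/-- The functionals in `S` have no common nonzero kernel vector. -/
def SeparatesVectors (S : Finset (StrongDual ℝ E)) : Prop :=
  ∀ u : E, (∀ l ∈ S, l u = 0) → u = 0

variable {P : Set E} {Φ : Finset (StrongDual ℝ E)} {b : StrongDual ℝ E → ℝ}

theorem exists_pos_forall_add_smul_lt (Ψ : Finset (StrongDual ℝ E)) (x u : E)
    (hx : ∀ l ∈ Ψ, l x < b l) : ∃ ε : ℝ, 0 < ε ∧ ∀ l ∈ Ψ, l (x + ε • u) < b l := by
  have hev : ∀ᶠ ε : ℝ in nhds 0, ∀ l ∈ Ψ, l (x + ε • u) < b l := by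
    rw [Filter.eventually_all_finset]
    intro l hl
    have hc : Continuous fun ε : ℝ => l (x + ε • u) := by fun_prop
    exact hc.continuousAt.eventually_lt continuousAt_const (by simpa using hx l hl)
  obtain ⟨ε, hε, hpos⟩ :=
    ((hev.filter_mono nhdsWithin_le_nhds).and (self_mem_nhdsWithin (s := Set.Ioi (0 : ℝ)))).exists
  exact ⟨ε, hpos, hε⟩

namespace IsHalfspacePresentation

variable (hP : IsHalfspacePresentation P Φ b)
include hP

theorem lt_of_notMem_active {x : E} (hx : x ∈ P) {l : StrongDual ℝ E} (hl : l ∈ Φ)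
    (hlx : l ∉ activeConstraints Φ b x) : l x < b l :=
  lt_of_le_of_ne ((hP.mem_iff x).1 hx l hl) fun h => hlx (mem_activeConstraints.2 ⟨hl, h⟩)

/-- A feasible direction can be followed for a short time without making an inactive constraint
tight. -/
theorem exists_pos_add_smul_mem {x u : E} (hx : x ∈ P)
    (hu : ∀ l ∈ activeConstraints Φ b x, l u ≤ 0) :
    ∃ ε : ℝ, 0 < ε ∧ x + ε • u ∈ P ∧
      ∀ l ∈ Φ, l ∉ activeConstraints Φ b x → l (x + ε • u) < b l := by
  classical
  obtain ⟨ε, hε, h⟩ := exists_pos_forall_add_smul_lt (b := b)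
    (Φ.filter (· ∉ activeConstraints Φ b x)) x u fun l hl => by
      rw [Finset.mem_filter] at hl
      exact hP.lt_of_notMem_active hx hl.1 hl.2
  have h' : ∀ l ∈ Φ, l ∉ activeConstraints Φ b x → l (x + ε • u) < b l :=
    fun l hl hlx => h l (Finset.mem_filter.2 ⟨hl, hlx⟩)
  refine ⟨ε, hε, (hP.mem_iff _).2 fun l hl => ?_, h'⟩
  by_cases hlx : l ∈ activeConstraints Φ b x
  · have h1 := mul_nonpos_of_nonneg_of_nonpos hε.le (hu l hlx)
    have h2 := (mem_activeConstraints.1 hlx).2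
    rw [map_add, map_smul, smul_eq_mul]
    linarith
  · exact (h' l hl hlx).le

theorem exists_pos_apply {x u : E} (hx : x ∈ P) (hu : u ≠ 0) : ∃ l ∈ Φ, 0 < l u := by
  by_contra! hcon
  obtain ⟨R, hR⟩ := hP.isBounded.exists_norm_le
  have hmem : ∀ t : ℝ, 0 ≤ t → x + t • u ∈ P := fun t ht => (hP.mem_iff _).2 fun l hl => by
    rw [map_add, map_smul, smul_eq_mul]
    linarith [(hP.mem_iff x).1 hx l hl, mul_nonpos_of_nonneg_of_nonpos ht (hcon l hl)]
  have hu' : 0 < ‖u‖ := norm_pos_iff.2 hu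
  have hR0 : 0 ≤ R := (norm_nonneg x).trans (hR x hx)
  have ht : 0 ≤ (R + ‖x‖ + 1) / ‖u‖ := by positivity
  have h1 := hR _ (hmem _ ht)
  have h2 : ‖((R + ‖x‖ + 1) / ‖u‖) • u‖ = R + ‖x‖ + 1 := by
    rw [norm_smul, Real.norm_of_nonneg ht, div_mul_cancel₀ _ hu'.ne']
  have h3 := norm_sub_le (x + ((R + ‖x‖ + 1) / ‖u‖) • u) x
  rw [add_sub_cancel_left, h2] at h3
  linarith

/-- Every point of `P` lies in the relative interior of a face having a vertex `v`. -/
theorem exists_vertex {y : E} (hy : y ∈ P) :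
    ∃ v ∈ P, activeConstraints Φ b y ⊆ activeConstraints Φ b v ∧
      SeparatesVectors (activeConstraints Φ b v) := by
  set T : Set E := {v | v ∈ P ∧ activeConstraints Φ b y ⊆ activeConstraints Φ b v} with hT
  set f : E → ℕ := fun v => Φ.card - (activeConstraints Φ b v).card with hf
  have hTne : T.Nonempty := ⟨y, hy, subset_rfl⟩
  have hv := Function.argminOn_mem f T hTne
  set v := Function.argminOn f T hTne with hvdef
  refine ⟨v, hv.1, hv.2, fun u hu => ?_⟩
  by_contra hu0
  obtain ⟨l₀, hl₀, hpos⟩ := hP.exists_pos_apply hv.1 hu0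
  obtain ⟨t, -, hle, l₁, hl₁, hpos₁, heq⟩ := exists_nonneg_forall_le_and_exists_eq Φ
    (fun l => l v) (fun l => l u) b ((hP.mem_iff v).1 hv.1) ⟨l₀, hl₀, hpos⟩
  have happ : ∀ l : StrongDual ℝ E, l (v + t • u) = l v + t * l u := by simp
  have hsub : activeConstraints Φ b v ⊆ activeConstraints Φ b (v + t • u) := fun l hl => by
    rw [mem_activeConstraints, happ, hu l hl, mul_zero, add_zero]
    exact mem_activeConstraints.1 hl
  have hss : activeConstraints Φ b v ⊂ activeConstraints Φ b (v + t • u) := by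
    refine Finset.ssubset_iff_subset_ne.2 ⟨hsub, fun h => ?_⟩
    have : l₁ ∈ activeConstraints Φ b v := by
      rw [h, mem_activeConstraints, happ]
      exact ⟨hl₁, heq⟩
    exact hpos₁.ne' (hu l₁ this)
  have hmem : v + t • u ∈ T :=
    ⟨(hP.mem_iff _).2 fun l hl => by rw [happ]; exact hle l hl, hv.2.trans hsub⟩
  have h1 : f v ≤ f (v + t • u) := Function.argminOn_le f T hmem
  have h2 := Finset.card_lt_card hss
  have h3 : (activeConstraints Φ b (v + t • u)).card ≤ Φ.card :=
    Finset.card_le_card (Finset.filter_subset _ _)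
  simp only [hf] at h1
  omega

omit hP in
theorem _root_.tightFace_eq_exposed {S : Finset (StrongDual ℝ E)}
    (hS : ∀ x ∈ P, ∀ l ∈ S, l x ≤ b l) {y : E} (hy : y ∈ tightFace P b S) :
    tightFace P b S = {x | x ∈ P ∧ ∀ z ∈ P, (∑ l ∈ S, l) z ≤ (∑ l ∈ S, l) x} := by
  ext x
  have hmax : ∀ z ∈ P, (∑ l ∈ S, l) z ≤ ∑ l ∈ S, b l := fun z hz => by
    rw [sum_apply]
    exact Finset.sum_le_sum fun l hl => hS z hz l hl
  refine ⟨fun hx => ⟨hx.1, fun z hz => (hmax z hz).trans_eq ?_⟩, fun hx => ⟨hx.1, ?_⟩⟩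
  · rw [sum_apply]
    exact Finset.sum_congr rfl fun l hl => (hx.2 l hl).symm
  · have h1 : ∑ l ∈ S, l x = ∑ l ∈ S, b l := by
      refine le_antisymm (by simpa using hmax x hx.1) ?_
      have := hx.2 y hy.1
      rw [sum_apply, sum_apply] at this
      rwa [Finset.sum_congr rfl fun l hl => hy.2 l hl] at this
    exact (Finset.sum_eq_sum_iff_of_le fun l hl => hS x hx.1 l hl).1 h1

theorem isExposed_tightFace {S : Finset (StrongDual ℝ E)} (hS : S ⊆ Φ) :
    IsExposed ℝ P (tightFace P b S) := fun ⟨_, hy⟩ =>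
  ⟨∑ l ∈ S, l, tightFace_eq_exposed (fun x hx l hl => (hP.mem_iff x).1 hx l (hS hl)) hy⟩

omit hP in
/-- A point is a zero-dimensional exposed face as soon as its active constraints separate
vectors. -/
theorem _root_.tightFace_active_eq_singleton {v : E} (hv : v ∈ P)
    (hsep : SeparatesVectors (activeConstraints Φ b v)) :
    tightFace P b (activeConstraints Φ b v) = {v} := by
  ext x
  refine ⟨fun hx => sub_eq_zero.1 (hsep _ fun l hl => ?_), ?_⟩
  · rw [map_sub, hx.2 l hl, (mem_activeConstraints.1 hl).2, sub_self]
  · rintro rfl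
    exact ⟨hv, fun l hl => (mem_activeConstraints.1 hl).2⟩

end IsHalfspacePresentation

variable [FiniteDimensional ℝ E]

theorem SeparatesVectors.exists_forall_apply_eq {S : Finset (StrongDual ℝ E)}
    (hsep : SeparatesVectors S) (hcard : S.card = Module.finrank ℝ E)
    (g : StrongDual ℝ E → ℝ) : ∃ w : E, ∀ l ∈ S, l w = g l := by
  let f : E →ₗ[ℝ] (S → ℝ) := LinearMap.pi fun l => (l.1 : E →ₗ[ℝ] ℝ)
  have hinj : Function.Injective f := by
    rw [← LinearMap.ker_eq_bot, LinearMap.ker_eq_bot']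
    exact fun u hu => hsep u fun l hl => congrFun hu ⟨l, hl⟩
  have hfr : Module.finrank ℝ E = Module.finrank ℝ (S → ℝ) := by simp [hcard]
  obtain ⟨w, hw⟩ := (LinearMap.injective_iff_surjective_of_finrank_eq_finrank hfr).1 hinj
    fun l => g l.1
  exact ⟨w, fun l hl => congrFun hw ⟨l, hl⟩⟩

namespace IsHalfspacePresentation

variable (hP : IsHalfspacePresentation P Φ b)
  (hsimple : ∀ v ∈ P, SeparatesVectors (activeConstraints Φ b v) →
    (activeConstraints Φ b v).card = Module.finrank ℝ E)
include hP hsimple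

theorem exists_forall_apply_eq {y : E} (hy : y ∈ P) (g : StrongDual ℝ E → ℝ) :
    ∃ w : E, ∀ l ∈ activeConstraints Φ b y, l w = g l := by
  obtain ⟨v, hv, hsub, hsep⟩ := hP.exists_vertex hy
  obtain ⟨w, hw⟩ := hsep.exists_forall_apply_eq (hsimple v hv hsep) g
  exact ⟨w, fun l hl => hw l (hsub hl)⟩

omit [FiniteDimensional ℝ E] in
theorem card_active_le {y : E} (hy : y ∈ P) :
    (activeConstraints Φ b y).card ≤ Module.finrank ℝ E := by
  obtain ⟨v, hv, hsub, hsep⟩ := hP.exists_vertex hy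
  exact (Finset.card_le_card hsub).trans_eq (hsimple v hv hsep)

theorem exists_active_eq {y : E} (hy : y ∈ P) {S : Finset (StrongDual ℝ E)}
    (hS : S ⊆ activeConstraints Φ b y) : ∃ z ∈ P, activeConstraints Φ b z = S := by
  classical
  obtain ⟨w, hw⟩ := hP.exists_forall_apply_eq hsimple hy fun l => if l ∈ S then 0 else -1
  obtain ⟨ε, hε, hmem, hlt⟩ := hP.exists_pos_add_smul_mem (u := w) hy fun l hl => by
    rw [hw l hl]; split_ifs <;> norm_num
  refine ⟨y + ε • w, hmem, ?_⟩
  ext l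
  rw [mem_activeConstraints]
  refine ⟨fun ⟨hl, heq⟩ => ?_, fun hl => ?_⟩
  · have hly : l ∈ activeConstraints Φ b y := by
      by_contra hly
      exact (hlt l hl hly).ne heq
    by_contra hlS
    rw [map_add, map_smul, hw l hly, if_neg hlS, (mem_activeConstraints.1 hly).2,
      smul_eq_mul] at heq
    linarith
  · have hly := hS hl
    rw [map_add, map_smul, hw l hly, if_pos hl, smul_zero, add_zero]
    exact mem_activeConstraints.1 hly

theorem tightFace_injOn {y : E} (hy : y ∈ P) :
    Set.InjOn (tightFace P b) {S | S ⊆ activeConstraints Φ b y} := by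
  have key : ∀ S T : Finset (StrongDual ℝ E), S ⊆ activeConstraints Φ b y →
      T ⊆ activeConstraints Φ b y → tightFace P b S ⊆ tightFace P b T → T ⊆ S := by
    intro S T hS hT h l hl
    obtain ⟨z, hz, rfl⟩ := hP.exists_active_eq hsimple hy hS
    exact mem_activeConstraints.2 ⟨(mem_activeConstraints.1 (hT hl)).1,
      (h ⟨hz, fun k hk => (mem_activeConstraints.1 hk).2⟩).2 l hl⟩
  intro S hS T hT h
  exact (key T S hT hS h.ge).antisymm (key S T hS hT h.le)

theorem finrank_direction_tightFace {y : E} (hy : y ∈ P) {S : Finset (StrongDual ℝ E)}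
    (hS : S ⊆ activeConstraints Φ b y) :
    Module.finrank ℝ (affineSpan ℝ (tightFace P b S)).direction =
      Module.finrank ℝ E - S.card := by
  let f : E →ₗ[ℝ] (S → ℝ) := LinearMap.pi fun l => (l.1 : E →ₗ[ℝ] ℝ)
  have hsurj : LinearMap.range f = ⊤ := by
    refine LinearMap.range_eq_top.2 fun g => ?_
    classical
    obtain ⟨w, hw⟩ := hP.exists_forall_apply_eq hsimple hy
      fun l => if h : l ∈ S then g ⟨l, h⟩ else 0
    refine ⟨w, funext fun l => ?_⟩
    have := hw l.1 (hS l.2)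
    rwa [dif_pos l.2] at this
  have hker : (affineSpan ℝ (tightFace P b S)).direction = LinearMap.ker f := by
    rw [direction_affineSpan]
    apply le_antisymm
    · rw [vectorSpan_def, Submodule.span_le]
      rintro _ ⟨x, hx, z, hz, rfl⟩
      refine LinearMap.mem_ker.2 (funext fun l => ?_)
      change l.1 (x - z) = 0
      rw [map_sub, hx.2 l l.2, hz.2 l l.2, sub_self]
    · intro u hu
      have hu' : ∀ l ∈ S, l u = 0 := fun l hl => congrFun (LinearMap.mem_ker.1 hu) ⟨l, hl⟩
      obtain ⟨z, hz, rfl⟩ := hP.exists_active_eq hsimple hy hS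
      obtain ⟨ε, hε, hmem, -⟩ := hP.exists_pos_add_smul_mem hz fun l hl => (hu' l hl).le
      have hzF : z ∈ tightFace P b (activeConstraints Φ b z) :=
        ⟨hz, fun l hl => (mem_activeConstraints.1 hl).2⟩
      have hzF' : z + ε • u ∈ tightFace P b (activeConstraints Φ b z) :=
        ⟨hmem, fun l hl => by
          rw [map_add, map_smul, hu' l hl, smul_zero, add_zero]
          exact (mem_activeConstraints.1 hl).2⟩
      have h := vsub_mem_vectorSpan ℝ hzF' hzF
      rw [vsub_eq_sub, add_sub_cancel_left] at h
      exact (Submodule.smul_mem_iff _ hε.ne').1 h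
  have h := f.finrank_range_add_finrank_ker
  rw [hsurj, finrank_top] at h
  simp only [Module.finrank_fintype_fun_eq_card, Fintype.card_coe] at h
  rw [hker]
  omega

/-- Every exposed face through `y` is cut out by some of the constraints active at `y`. -/
theorem exists_eq_tightFace {F : Set E} (hF : IsExposed ℝ P F) {y : E} (hyF : y ∈ F) :
    ∃ S ⊆ activeConstraints Φ b y, F = tightFace P b S := by
  classical
  obtain ⟨f, hf⟩ := hF ⟨y, hyF⟩
  have hy : y ∈ P ∧ ∀ z ∈ P, f z ≤ f y := by rw [hf] at hyF; exact hyF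
  obtain ⟨v, hv, hsub, hsep⟩ := hP.exists_vertex hy.1
  have hvy : f v = f y := by
    obtain ⟨ε, hε, hmem, -⟩ := hP.exists_pos_add_smul_mem (u := y - v) hy.1 fun l hl => by
      rw [map_sub, (mem_activeConstraints.1 hl).2, (mem_activeConstraints.1 (hsub hl)).2, sub_self]
    have h1 := hy.2 _ hmem
    rw [map_add, map_smul, map_sub, smul_eq_mul] at h1
    have h2 := hy.2 v hv
    have h3 : ε * (f y - f v) ≤ 0 := by linarith
    have h4 : f y - f v ≤ 0 := nonpos_of_mul_nonpos_right h3 hε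
    linarith
  have hmax : ∀ z ∈ P, f z ≤ f v := fun z hz => hvy ▸ hy.2 z hz
  set A := activeConstraints Φ b v with hA
  have hw : ∀ k : StrongDual ℝ E, ∃ w : E, ∀ l ∈ A, l w = if l = k then -1 else 0 := fun k =>
    hsep.exists_forall_apply_eq (hsimple v hv hsep) fun l => if l = k then -1 else 0
  choose w hw using hw
  have hnonpos : ∀ k ∈ A, f (w k) ≤ 0 := by
    intro k hk
    obtain ⟨ε, hε, hmem, -⟩ := hP.exists_pos_add_smul_mem (u := w k) hv fun l hl => by
      rw [hw k l hl]; split_ifs <;> norm_num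
    have h1 := hmax _ hmem
    rw [map_add, map_smul, smul_eq_mul] at h1
    exact nonpos_of_mul_nonpos_right (by linarith : ε * f (w k) ≤ 0) hε
  have hexp : ∀ u : E, f u = ∑ k ∈ A, k u * -f (w k) := by
    intro u
    have h0 : u + ∑ k ∈ A, k u • w k = 0 := by
      refine hsep _ fun l hl => ?_
      rw [map_add, map_sum]
      have : ∀ k ∈ A, l (k u • w k) = if l = k then -(k u) else 0 := fun k _ => by
        rw [map_smul, hw k l hl, smul_eq_mul]
        split_ifs <;> simp
      rw [Finset.sum_congr rfl this, Finset.sum_ite_eq, if_pos hl, add_neg_cancel]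
    have h1 := congrArg f h0
    rw [map_add, map_sum, map_zero] at h1
    simp only [map_smul, smul_eq_mul] at h1
    simp only [mul_neg, Finset.sum_neg_distrib]
    linarith
  have hFeq : F = tightFace P b (A.filter fun k => f (w k) ≠ 0) := by
    ext x
    have hx_iff : x ∈ P → (f x = f v ↔ ∀ k ∈ A.filter (fun k => f (w k) ≠ 0), k x = b k) := by
      intro hx
      have hterm : ∀ k ∈ A, k (x - v) * -f (w k) ≤ 0 := fun k hk => by
        refine mul_nonpos_of_nonpos_of_nonneg ?_ (neg_nonneg.2 (hnonpos k hk))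
        rw [map_sub, (mem_activeConstraints.1 hk).2]
        linarith [(hP.mem_iff x).1 hx k (mem_activeConstraints.1 hk).1]
      rw [← sub_eq_zero, ← map_sub, hexp, Finset.sum_eq_zero_iff_of_nonpos hterm]
      refine ⟨fun h k hk => ?_, fun h k hk => ?_⟩
      · rw [Finset.mem_filter] at hk
        have := (mul_eq_zero.1 (h k hk.1)).resolve_right (neg_ne_zero.2 hk.2)
        rw [map_sub, (mem_activeConstraints.1 hk.1).2] at this
        linarith
      · by_cases h0 : f (w k) = 0
        · rw [h0, neg_zero, mul_zero]
        · rw [map_sub, h k (Finset.mem_filter.2 ⟨hk, h0⟩), (mem_activeConstraints.1 hk).2,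
            sub_self, zero_mul]
    rw [hf]
    refine ⟨fun hx => ⟨hx.1, (hx_iff hx.1).1 (le_antisymm (hmax x hx.1) (hx.2 v hv))⟩,
      fun hx => ⟨hx.1, fun z hz => ?_⟩⟩
    rw [(hx_iff hx.1).2 hx.2]
    exact hmax z hz
  refine ⟨_, fun l hl => ?_, hFeq⟩
  have hlA := (Finset.mem_filter.1 hl).1
  rw [hFeq] at hyF
  exact mem_activeConstraints.2 ⟨(mem_activeConstraints.1 hlA).1, hyF.2 l hl⟩

end IsHalfspacePresentation

end HalfspacePresentation

section FacetNormals

variable {E : Type*} [NormedAddCommGroup E] [NormedSpace ℝ E]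

theorem eq_zero_of_forall_le_of_mem_interior {P : Set E} {p : E} (hp : p ∈ interior P)
    {u : StrongDual ℝ E} (hu : ∀ x ∈ P, u x ≤ u p) : u = 0 := by
  have hmax : IsLocalMax u p :=
    Filter.mem_of_superset (mem_interior_iff_mem_nhds.1 hp) fun x hx => hu x hx
  exact hmax.hasFDerivAt_eq_zero u.hasFDerivAt

theorem apply_le_of_mem_convexHull {s : Set E} {u : StrongDual ℝ E} {c : ℝ}
    (hu : ∀ v ∈ s, u v ≤ c) {x : E} (hx : x ∈ convexHull ℝ s) : u x ≤ c :=
  convexHull_min (fun v hv => hu v hv)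
    (convex_halfSpace_le u.toLinearMap.isLinear c) hx

/-- The functionals `l` such that `l (v - p) ≤ 1` is valid on `V` and the points of `V` where
equality holds determine `l`. For `p` in the interior of the convex hull of `V`, these are the
normalized facet normals. -/
def facetNormals (V : Finset E) (p : E) : Set (StrongDual ℝ E) :=
  {l | (∀ v ∈ V, l (v - p) ≤ 1) ∧
    ∀ u : StrongDual ℝ E, (∀ v ∈ V, l (v - p) = 1 → u (v - p) = 0) → u = 0}

variable {V : Finset E} {p : E}

theorem eq_of_mem_facetNormals {l l' : StrongDual ℝ E} (hl : l ∈ facetNormals V p)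
    (h : ∀ v ∈ V, l (v - p) = 1 → l' (v - p) = 1) : l = l' :=
  sub_eq_zero.1 (hl.2 (l - l') fun v hv hv1 => by
    rw [sub_apply, hv1, h v hv hv1, sub_self])

theorem finite_facetNormals (V : Finset E) (p : E) : (facetNormals V p).Finite := by
  refine Set.Finite.of_finite_image (f := fun l => V.filter fun v => l (v - p) = 1)
    ((V.powerset.finite_toSet).subset ?_) ?_
  · rintro _ ⟨l, -, rfl⟩
    exact Finset.mem_coe.2 (Finset.mem_powerset.2 (Finset.filter_subset _ _))
  · intro l hl l' _ h
    refine eq_of_mem_facetNormals hl fun v hv hv1 => ?_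
    have : v ∈ V.filter fun v => l' (v - p) = 1 := by
      exact h.le (Finset.mem_filter.2 ⟨hv, hv1⟩)
    exact (Finset.mem_filter.1 this).2

theorem apply_sub_le_one {l : StrongDual ℝ E} (hl : ∀ v ∈ V, l (v - p) ≤ 1) {x : E}
    (hx : x ∈ convexHull ℝ (V : Set E)) : l (x - p) ≤ 1 := by
  have := apply_le_of_mem_convexHull (u := l) (c := 1 + l p) (s := (V : Set E))
    (fun v hv => by have := hl v hv; rw [map_sub] at this; linarith) hx
  rw [map_sub]
  linarith

/-- A functional valid on `V` and violated at `x` can be rotated to a facet normal violated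
at `x`. -/
theorem exists_mem_facetNormals_one_lt (hp : p ∈ interior (convexHull ℝ (V : Set E))) {x : E}
    {l₀ : StrongDual ℝ E} (hl₀ : ∀ v ∈ V, l₀ (v - p) ≤ 1) (hx : 1 < l₀ (x - p)) :
    ∃ l ∈ facetNormals V p, 1 < l (x - p) := by
  set T : Set (StrongDual ℝ E) := {l | (∀ v ∈ V, l (v - p) ≤ 1) ∧ 1 < l (x - p)}
  set f : StrongDual ℝ E → ℕ := fun l => V.card - (V.filter fun v => l (v - p) = 1).card with hf
  have hTne : T.Nonempty := ⟨l₀, hl₀, hx⟩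
  have hl := Function.argminOn_mem f T hTne
  set l := Function.argminOn f T hTne with hldef
  refine ⟨l, ⟨hl.1, fun u hu => ?_⟩, hl.2⟩
  by_contra hu0
  obtain ⟨w, hw0, hwx, hw⟩ : ∃ w : StrongDual ℝ E, w ≠ 0 ∧ 0 ≤ w (x - p) ∧
      ∀ v ∈ V, l (v - p) = 1 → w (v - p) = 0 := by
    rcases le_total 0 (u (x - p)) with h | h
    · exact ⟨u, hu0, h, hu⟩
    · exact ⟨-u, neg_ne_zero.2 hu0, by simpa using h, fun v hv hv1 => by simp [hu v hv hv1]⟩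
  have hpos : ∃ v ∈ V, 0 < w (v - p) := by
    by_contra! hcon
    refine hw0 (eq_zero_of_forall_le_of_mem_interior hp fun y hy =>
      apply_le_of_mem_convexHull (fun v hv => ?_) hy)
    have := hcon v hv
    rw [map_sub] at this
    linarith
  obtain ⟨t, ht, hle, v₁, hv₁, hpos₁, heq⟩ := exists_nonneg_forall_le_and_exists_eq V
    (fun v => l (v - p)) (fun v => w (v - p)) (fun _ => 1) hl.1 hpos
  have happ : ∀ y, (l + t • w) y = l y + t * w y := fun y => by simp
  have hss : V.filter (fun v => l (v - p) = 1) ⊂ V.filter (fun v => (l + t • w) (v - p) = 1) := by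
    refine Finset.ssubset_iff_subset_ne.2 ⟨fun v hv => ?_, fun h => ?_⟩
    · rw [Finset.mem_filter] at hv ⊢
      rw [happ, hw v hv.1 hv.2, mul_zero, add_zero]
      exact hv
    · have : v₁ ∈ V.filter fun v => l (v - p) = 1 := by
        rw [h, Finset.mem_filter, happ]
        exact ⟨hv₁, heq⟩
      exact hpos₁.ne' (hw v₁ hv₁ (Finset.mem_filter.1 this).2)
  have hmem : l + t • w ∈ T :=
    ⟨fun v hv => by rw [happ]; exact hle v hv, by
      rw [happ]; linarith [hl.2, mul_nonneg ht hwx]⟩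
  have h1 : f l ≤ f (l + t • w) := Function.argminOn_le f T hmem
  have h2 := Finset.card_lt_card hss
  have h3 : (V.filter fun v => (l + t • w) (v - p) = 1).card ≤ V.card :=
    Finset.card_le_card (Finset.filter_subset _ _)
  simp only [hf] at h1
  omega

theorem isHalfspacePresentation_facetNormals (hp : p ∈ interior (convexHull ℝ (V : Set E))) :
    IsHalfspacePresentation (convexHull ℝ (V : Set E)) (finite_facetNormals V p).toFinset
      (fun l => 1 + l p) where
  isBounded := isBounded_convexHull.2 V.finite_toSet.isBounded
  mem_iff x := by
    simp only [Set.Finite.mem_toFinset]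
    refine ⟨fun hx l hl => ?_, fun h => ?_⟩
    · have := apply_sub_le_one hl.1 hx
      rw [map_sub] at this
      linarith
    · by_contra hx
      obtain ⟨f, r, hfr, hr⟩ := geometric_hahn_banach_closed_point (convex_convexHull ℝ (V : Set E))
        (V.finite_toSet.isCompact_convexHull ℝ).isClosed hx
      have hpos : 0 < r - f p := sub_pos.2 (hfr p (interior_subset hp))
      obtain ⟨l, hl, hlx⟩ := exists_mem_facetNormals_one_lt (l₀ := (r - f p)⁻¹ • f) (x := x) hp
        (fun v hv => by
          have := hfr v (subset_convexHull ℝ _ hv)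
          rw [smul_apply, map_sub, smul_eq_mul, inv_mul_le_one₀ hpos]
          linarith)
        (by
          rw [smul_apply, map_sub, smul_eq_mul, one_lt_inv_mul₀ hpos]
          linarith)
      have := h l hl
      rw [map_sub] at hlx
      linarith

theorem tightFace_singleton_injOn :
    Set.InjOn (fun l => tightFace (convexHull ℝ (V : Set E)) (fun l => 1 + l p) {l})
      (facetNormals V p) := by
  intro l hl l' _ h
  refine eq_of_mem_facetNormals hl fun v hv hv1 => ?_
  have : v ∈ tightFace (convexHull ℝ (V : Set E)) (fun l => 1 + l p) {l'} := by
    refine h.le ⟨subset_convexHull ℝ _ hv, fun k hk => ?_⟩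
    rw [Finset.mem_singleton.1 hk]
    rw [map_sub] at hv1
    linarith
  have := this.2 l' (Finset.mem_singleton_self _)
  rw [map_sub]
  linarith

theorem apply_sub_eq_zero_of_active {l u : StrongDual ℝ E} (hl : ∀ v ∈ V, l (v - p) ≤ 1)
    (hu : ∀ v ∈ V, l (v - p) = 1 → u (v - p) = 0) {x : E}
    (hx : x ∈ convexHull ℝ (V : Set E)) (hlx : l (x - p) = 1) : u (x - p) = 0 := by
  obtain ⟨w, hw0, hw1, rfl⟩ := Finset.mem_convexHull'.1 hx
  have hsub : ∑ v ∈ V, w v • v - p = ∑ v ∈ V, w v • (v - p) := by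
    simp only [smul_sub, Finset.sum_sub_distrib, ← Finset.sum_smul, hw1, one_smul]
  rw [hsub] at hlx ⊢
  rw [map_sum] at hlx ⊢
  simp only [map_smul, smul_eq_mul] at hlx ⊢
  have hle : ∀ v ∈ V, w v * l (v - p) ≤ w v := fun v hv =>
    mul_le_of_le_one_right (hw0 v hv) (hl v hv)
  have heq := (Finset.sum_eq_sum_iff_of_le hle).1 (hlx.trans hw1.symm)
  refine Finset.sum_eq_zero fun v hv => ?_
  by_cases h0 : w v = 0
  · rw [h0, zero_mul]
  · rw [hu v hv (by simpa [h0] using heq v hv), mul_zero]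

variable [FiniteDimensional ℝ E]

theorem StrongDual.finrank_ker_add_one {l : StrongDual ℝ E} (hl : l ≠ 0) :
    Module.finrank ℝ (LinearMap.ker (l : E →ₗ[ℝ] ℝ)) + 1 = Module.finrank ℝ E :=
  Module.Dual.finrank_ker_add_one_of_ne_zero (f := (l : E →ₗ[ℝ] ℝ))
    fun h => hl (ContinuousLinearMap.coe_injective h)

omit [FiniteDimensional ℝ E] in
theorem direction_tightFace_singleton_le {P : Set E} {b : StrongDual ℝ E → ℝ}
    (l : StrongDual ℝ E) :
    (affineSpan ℝ (tightFace P b {l})).direction ≤ LinearMap.ker (l : E →ₗ[ℝ] ℝ) := by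
  rw [direction_affineSpan, vectorSpan_def, Submodule.span_le]
  rintro _ ⟨x, hx, z, hz, rfl⟩
  change l (x - z) = 0
  rw [map_sub, hx.2 l (Finset.mem_singleton_self _), hz.2 l (Finset.mem_singleton_self _),
    sub_self]

omit [FiniteDimensional ℝ E] in
theorem exists_active_of_mem_facetNormals [Nontrivial E] {l : StrongDual ℝ E}
    (hl : l ∈ facetNormals V p) : ∃ v ∈ V, l (v - p) = 1 := by
  by_contra! hcon
  obtain ⟨w, hw⟩ := exists_ne (0 : E)
  obtain ⟨u, hu⟩ := SeparatingDual.exists_ne_zero (R := ℝ) hw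
  exact hu (by rw [hl.2 u fun v hv h => absurd h (hcon v hv)]; rfl)

theorem finrank_direction_of_mem_facetNormals [Nontrivial E] {l : StrongDual ℝ E}
    (hl : l ∈ facetNormals V p) :
    Module.finrank ℝ (affineSpan ℝ (tightFace (convexHull ℝ (V : Set E))
      (fun l => 1 + l p) {l})).direction + 1 = Module.finrank ℝ E := by
  obtain ⟨v₀, hv₀, hv₀1⟩ := exists_active_of_mem_facetNormals hl
  have hl0 : l ≠ 0 := by
    rintro rfl
    simp at hv₀1
  rw [← StrongDual.finrank_ker_add_one hl0]
  suffices h : (affineSpan ℝ (tightFace (convexHull ℝ (V : Set E))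
      (fun l => 1 + l p) {l})).direction = LinearMap.ker (l : E →ₗ[ℝ] ℝ) by rw [h]
  refine le_antisymm (direction_tightFace_singleton_le l) fun w hw => ?_
  by_contra hwD
  obtain ⟨f, hfw, hfD⟩ := Submodule.exists_le_ker_of_notMem hwD
  have hmem : ∀ v ∈ V, l (v - p) = 1 →
      v ∈ tightFace (convexHull ℝ (V : Set E)) (fun l => 1 + l p) {l} := fun v hv h =>
    ⟨subset_convexHull ℝ _ hv, fun k hk => by
      rw [Finset.mem_singleton.1 hk]
      rw [map_sub] at h
      linarith⟩
  have h0 : LinearMap.toContinuousLinearMap f - f (v₀ - p) • l = 0 := by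
    refine hl.2 _ fun v hv hv1 => ?_
    have h := hfD (direction_affineSpan ℝ (tightFace (convexHull ℝ (V : Set E)) _ {l}) ▸
      vsub_mem_vectorSpan ℝ (hmem v hv hv1) (hmem v₀ hv₀ hv₀1))
    rw [LinearMap.mem_ker, vsub_eq_sub, map_sub] at h
    rw [sub_apply, smul_apply, hv1, LinearMap.coe_toContinuousLinearMap', map_sub, map_sub,
      smul_eq_mul]
    linarith
  have h1 := DFunLike.congr_fun h0 w
  have h2 : l w = 0 := hw
  rw [sub_apply, smul_apply, h2, LinearMap.coe_toContinuousLinearMap'] at h1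
  simp at h1
  exact hfw h1

theorem exists_facetNormal_of_finrank (hp : p ∈ interior (convexHull ℝ (V : Set E))) {F : Set E}
    (hne : F.Nonempty) (hF : IsExposed ℝ (convexHull ℝ (V : Set E)) F)
    (hdim : Module.finrank ℝ (affineSpan ℝ F).direction + 1 = Module.finrank ℝ E) :
    ∃ l ∈ facetNormals V p,
      F = tightFace (convexHull ℝ (V : Set E)) (fun l => 1 + l p) {l} := by
  set P := convexHull ℝ (V : Set E) with hP
  obtain ⟨f, hf⟩ := hF hne
  obtain ⟨y, hy⟩ := hne
  have hyP : y ∈ P ∧ ∀ z ∈ P, f z ≤ f y := by rw [hf] at hy; exact hy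
  have hpos : 0 < f y - f p := by
    refine sub_pos.2 (lt_of_le_of_ne (hyP.2 p (interior_subset hp)) fun h => ?_)
    have hf0 : f = 0 := eq_zero_of_forall_le_of_mem_interior hp fun x hx => h ▸ hyP.2 x hx
    have hFP : F = P := by
      rw [hf, hf0]
      ext x
      simp
    have htop : affineSpan ℝ P = ⊤ :=
      (convex_convexHull ℝ (V : Set E)).interior_nonempty_iff_affineSpan_eq_top.1 ⟨p, hp⟩
    rw [hFP, htop, AffineSubspace.direction_top, finrank_top] at hdim
    omega
  set l : StrongDual ℝ E := (f y - f p)⁻¹ • f with hl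
  have hlx : ∀ x, l (x - p) = (f x - f p) / (f y - f p) := fun x => by
    rw [hl, smul_apply, map_sub, smul_eq_mul, inv_mul_eq_div]
  have hlV : ∀ v ∈ V, l (v - p) ≤ 1 := fun v hv => by
    rw [hlx, div_le_one hpos]
    linarith [hyP.2 v (subset_convexHull ℝ _ hv)]
  have hFl : F = tightFace P (fun l => 1 + l p) {l} := by
    rw [hf]
    ext x
    have hiff : l x = 1 + l p ↔ f x = f y := by
      rw [← sub_eq_iff_eq_add, ← map_sub, hlx, div_eq_one_iff_eq hpos.ne', sub_left_inj]
    refine ⟨fun hx => ⟨hx.1, fun k hk => ?_⟩, fun hx => ⟨hx.1, fun z hz => ?_⟩⟩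
    · rw [Finset.mem_singleton.1 hk, hiff]
      exact le_antisymm (hyP.2 x hx.1) (hx.2 y hyP.1)
    · rw [hiff.1 (hx.2 l (Finset.mem_singleton_self _))]
      exact hyP.2 z hz
  refine ⟨l, ⟨hlV, fun u hu => ?_⟩, hFl⟩
  have hly : l (y - p) = 1 := by rw [hlx, div_self hpos.ne']
  have hl0 : l ≠ 0 := by
    intro h
    rw [h] at hly
    simp at hly
  have huF : ∀ x ∈ F, u (x - p) = 0 := fun x hx => by
    rw [hFl] at hx
    refine apply_sub_eq_zero_of_active hlV hu hx.1 ?_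
    rw [map_sub, hx.2 l (Finset.mem_singleton_self _)]
    ring
  have hker : LinearMap.ker (l : E →ₗ[ℝ] ℝ) ≤ LinearMap.ker (u : E →ₗ[ℝ] ℝ) := by
    have hle : (affineSpan ℝ F).direction ≤ LinearMap.ker (l : E →ₗ[ℝ] ℝ) :=
      hFl ▸ direction_tightFace_singleton_le l
    rw [← Submodule.eq_of_le_of_finrank_eq hle
      (by have := StrongDual.finrank_ker_add_one hl0; omega),
      direction_affineSpan, vectorSpan_def, Submodule.span_le]
    rintro _ ⟨x, hx, z, hz, rfl⟩
    change u (x - z) = 0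
    rw [← sub_sub_sub_cancel_right x z p, map_sub, huF x hx, huF z hz, sub_self]
  ext z
  have hz : z - l z • (y - p) ∈ LinearMap.ker (l : E →ₗ[ℝ] ℝ) := by
    change l (z - l z • (y - p)) = 0
    rw [map_sub, map_smul, hly, smul_eq_mul, mul_one, sub_self]
  have h : u (z - l z • (y - p)) = 0 := hker hz
  rw [map_sub, map_smul, huF y hy, smul_zero, sub_zero] at h
  exact h

end FacetNormals

section LatticePolytope

theorem finite_setOf_latt_mem {ι : Type*} [Fintype ι] {B : Set (ι → ℝ)}
    (hB : Bornology.IsBounded B) : {x : ι → ℤ | latt x ∈ B}.Finite := by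
  classical
  obtain ⟨R, hR⟩ := hB.exists_norm_le
  refine (Set.finite_Icc (fun _ => -⌈R⌉ : ι → ℤ) (fun _ => ⌈R⌉)).subset fun x hx => ?_
  have habs : ∀ i, |(x i : ℝ)| ≤ ⌈R⌉ := fun i =>
    ((norm_le_pi_norm (latt x) i).trans (hR _ hx)).trans (Int.le_ceil R)
  refine ⟨fun i => ?_, fun i => ?_⟩
  · have := (abs_le.1 (habs i)).1
    exact_mod_cast this
  · have := (abs_le.1 (habs i)).2
    exact_mod_cast this

theorem latt_add {ι : Type*} (x y : ι → ℤ) : latt (x + y) = latt x + latt y :=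
  funext fun i => Int.cast_add (x i) (y i)

theorem latt_sum {ι κ : Type*} (s : Finset κ) (f : κ → ι → ℤ) :
    latt (∑ k ∈ s, f k) = ∑ k ∈ s, latt (f k) := by
  funext i
  simp [latt, Finset.sum_apply]

variable {n : ℕ} {V : Finset (Fin n → ℤ)} {P : Set (Fin n → ℝ)}
  {Φ : Finset (StrongDual ℝ (Fin n → ℝ))} {b : StrongDual ℝ (Fin n → ℝ) → ℝ}

namespace IsHalfspacePresentation

variable (hΦ : IsHalfspacePresentation P Φ b)
include hΦ

/-- Adding to a lattice point `x` of `m P`, for every constraint active at `x / m`, a vertex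
violating tightness of that constraint, produces an interior lattice point. -/
theorem cd_le_add_card_active (hPV : P = convexHull ℝ (latt '' (V : Set (Fin n → ℤ))))
    {p : Fin n → ℝ} (hp : p ∈ P) (hpb : ∀ l ∈ Φ, l p < b l)
    {m : ℕ} (hm : 1 ≤ m) {x : Fin n → ℤ} {y : Fin n → ℝ} (hy : y ∈ P)
    (hxy : latt x = (m : ℝ) • y) : cd P ≤ m + (activeConstraints Φ b y).card := by
  set A := activeConstraints Φ b y with hA
  have hex : ∀ l ∈ Φ, ∃ v ∈ V, l (latt v) < b l := by
    intro l hl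
    by_contra! hcon
    have := apply_le_of_mem_convexHull (u := -l) (c := -b l)
      (s := latt '' (V : Set (Fin n → ℤ))) (by
        rintro _ ⟨v, hv, rfl⟩
        simpa using hcon v hv) (hPV ▸ hp)
    have h2 := hpb l hl
    rw [neg_apply] at this
    linarith
  choose! w hwV hwlt using hex
  have hwP : ∀ l ∈ Φ, latt (w l) ∈ P := fun l hl =>
    hPV ▸ subset_convexHull ℝ _ ⟨w l, hwV l hl, rfl⟩
  have hAΦ : A ⊆ Φ := Finset.filter_subset _ _
  set z : Fin n → ℤ := x + ∑ l ∈ A, w l with hz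
  set k := m + A.card with hk
  have hk0 : (0 : ℝ) < k := by
    have : 0 < k := by omega
    exact_mod_cast this
  have hm0 : (0 : ℝ) < m := by exact_mod_cast hm
  have hzlt : ∀ l ∈ Φ, l (latt z) < k * b l := by
    intro l hl
    have hlz : l (latt z) = m * l y + ∑ a ∈ A, l (latt (w a)) := by
      rw [hz, latt_add, latt_sum, hxy, map_add, map_smul, map_sum, smul_eq_mul]
    have hsum : ∀ a ∈ A, l (latt (w a)) ≤ b l := fun a ha =>
      (hΦ.mem_iff _).1 (hwP a (hAΦ ha)) l hl
    have hkb : (k : ℝ) * b l = m * b l + ∑ _a ∈ A, b l := by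
      rw [Finset.sum_const, nsmul_eq_mul, hk]
      push_cast
      ring
    rw [hlz, hkb]
    by_cases hlA : l ∈ A
    · refine add_lt_add_of_le_of_lt ?_ (Finset.sum_lt_sum hsum ⟨l, hlA, hwlt l hl⟩)
      exact mul_le_mul_of_nonneg_left ((hΦ.mem_iff y).1 hy l hl) hm0.le
    · refine add_lt_add_of_lt_of_le ?_ (Finset.sum_le_sum hsum)
      exact mul_lt_mul_of_pos_left (hΦ.lt_of_notMem_active hy hl hlA) hm0
  refine Nat.sInf_le ⟨by omega, z, interior_subset_intrinsicInterior ?_⟩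
  have hopen : IsOpen {u : Fin n → ℝ | ∀ l ∈ Φ, l u < k * b l} := by
    simp only [Set.ofPred_forall]
    exact isOpen_biInter_finset fun l _ => isOpen_lt l.continuous continuous_const
  refine interior_maximal (fun u hu => ?_) hopen hzlt
  rw [Set.mem_smul_set_iff_inv_smul_mem₀ hk0.ne', hΦ.mem_iff]
  intro l hl
  rw [map_smul, smul_eq_mul, inv_mul_le_iff₀ hk0]
  exact (hu l hl).le

variable (hsimple : ∀ v ∈ P, SeparatesVectors (activeConstraints Φ b v) →
    (activeConstraints Φ b v).card = Module.finrank ℝ (Fin n → ℝ))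
include hsimple

theorem finite_exposed : {F | F.Nonempty ∧ IsExposed ℝ P F}.Finite := by
  refine (Φ.powerset.finite_toSet.image (tightFace P b)).subset ?_
  rintro F ⟨⟨y, hy⟩, hF⟩
  obtain ⟨S, hS, rfl⟩ := hΦ.exists_eq_tightFace hsimple hF hy
  exact ⟨S, Finset.mem_coe.2 (Finset.mem_powerset.2 (hS.trans (Finset.filter_subset _ _))), rfl⟩

open Classical in
/-- The faces through a point `y` correspond to the sets of constraints active at `y`. -/
theorem sum_exposed_through {𝓕 : Finset (Set (Fin n → ℝ))}
    (h𝓕 : ∀ F, F ∈ 𝓕 ↔ F.Nonempty ∧ IsExposed ℝ P F) {y : Fin n → ℝ} (hy : y ∈ P) (g : ℕ → ℤ) :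
    ∑ F ∈ 𝓕 with y ∈ F, g (Module.finrank ℝ (affineSpan ℝ F).direction) =
      ∑ S ∈ (activeConstraints Φ b y).powerset, g (n - S.card) := by
  have himg : 𝓕.filter (y ∈ ·) = (activeConstraints Φ b y).powerset.image (tightFace P b) := by
    ext F
    simp only [Finset.mem_filter, Finset.mem_image, Finset.mem_powerset, h𝓕]
    constructor
    · rintro ⟨⟨-, hF⟩, hyF⟩
      obtain ⟨S, hS, rfl⟩ := hΦ.exists_eq_tightFace hsimple hF hyF
      exact ⟨S, hS, rfl⟩
    · rintro ⟨S, hS, rfl⟩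
      have hyS : y ∈ tightFace P b S := ⟨hy, fun l hl => (mem_activeConstraints.1 (hS hl)).2⟩
      exact ⟨⟨⟨y, hyS⟩, hΦ.isExposed_tightFace (hS.trans (Finset.filter_subset _ _))⟩, hyS⟩
  rw [himg, Finset.sum_image fun S hS T hT h => hΦ.tightFace_injOn hsimple hy
    (Finset.mem_powerset.1 hS) (Finset.mem_powerset.1 hT) h]
  refine Finset.sum_congr rfl fun S hS => ?_
  rw [hΦ.finrank_direction_tightFace hsimple hy (Finset.mem_powerset.1 hS),
    Module.finrank_fin_fun]

theorem sum_exposed_through_eq_zero {𝓕 : Finset (Set (Fin n → ℝ))}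
    (h𝓕 : ∀ F, F ∈ 𝓕 ↔ F.Nonempty ∧ IsExposed ℝ P F) {y : Fin n → ℝ} (hy : y ∈ P) {e : ℕ}
    (he : e < (activeConstraints Φ b y).card) [DecidablePred fun F : Set (Fin n → ℝ) => y ∈ F] :
    ∑ F ∈ 𝓕 with y ∈ F, (-1 : ℤ) ^ Module.finrank ℝ (affineSpan ℝ F).direction *
      ((Module.finrank ℝ (affineSpan ℝ F).direction + 1).choose e : ℤ) = 0 := by
  classical
  have hcard := hΦ.card_active_le hsimple hy
  rw [Module.finrank_fin_fun] at hcard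
  have h := hΦ.sum_exposed_through hsimple h𝓕 hy fun j => (-1 : ℤ) ^ j * ((j + 1).choose e : ℤ)
  have h0 := sum_powerset_neg_one_pow_mul_choose_eq_zero (activeConstraints Φ b y) (n + 1) e he
    (by omega)
  have h1 : ∑ S ∈ (activeConstraints Φ b y).powerset,
      (-1 : ℤ) ^ (n - S.card) * ((n - S.card + 1).choose e : ℤ) = (-1) ^ n *
        ∑ S ∈ (activeConstraints Φ b y).powerset,
          (-1 : ℤ) ^ S.card * ((n + 1 - S.card).choose e : ℤ) := by
    rw [Finset.mul_sum]
    refine Finset.sum_congr rfl fun S hS => ?_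
    have hS' := Finset.card_le_card (Finset.mem_powerset.1 hS)
    obtain ⟨r, hr⟩ : ∃ r, n = r + S.card := ⟨n - S.card, by omega⟩
    have hsq : ((-1 : ℤ) ^ S.card) * (-1) ^ S.card = 1 := by
      rw [← mul_pow]
      norm_num
    have hpow : (-1 : ℤ) ^ n = (-1) ^ r * (-1) ^ S.card := by rw [← pow_add, ← hr]
    rw [show n - S.card = r by omega, show n + 1 - S.card = r + 1 by omega, hpow]
    linear_combination (-(-1 : ℤ) ^ r * ((r + 1).choose e : ℤ)) * hsq
  rw [h1, h0, mul_zero] at h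
  convert h

end IsHalfspacePresentation

open Classical in
theorem lattCount_eq_sum {F : Set (Fin n → ℝ)} (hFP : F ⊆ P) {m : ℕ} (hm : 1 ≤ m)
    {X : Finset (Fin n → ℤ)} (hX : ∀ x, x ∈ X ↔ latt x ∈ (m : ℝ) • P) :
    (lattCount F m : ℤ) = ∑ x ∈ X, if (m : ℝ)⁻¹ • latt x ∈ F then 1 else 0 := by
  have hm0 : (m : ℝ) ≠ 0 := by
    have : m ≠ 0 := by omega
    exact_mod_cast this
  have hset : {x : Fin n → ℤ | latt x ∈ (m : ℝ) • F} =
      ((X.filter fun x => (m : ℝ)⁻¹ • latt x ∈ F : Finset (Fin n → ℤ)) : Set (Fin n → ℤ)) := by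
    ext x
    rw [Set.mem_ofPred_eq, Finset.coe_filter, Set.mem_ofPred_eq, hX,
      ← Set.mem_smul_set_iff_inv_smul_mem₀ hm0]
    exact ⟨fun h => ⟨Set.smul_set_mono hFP h, h⟩, fun h => h.2⟩
  rw [lattCount, hset, Set.ncard_coe_finset, Finset.card_filter]
  push_cast
  rfl

/-- A simple polytope has exactly `n` facet normals active at every vertex. -/
theorem IsSimplePolytope.card_active_eq (hn : 1 ≤ n) {W : Finset (Fin n → ℝ)} {p : Fin n → ℝ}
    (hp : p ∈ interior (convexHull ℝ (W : Set (Fin n → ℝ))))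
    (hsimple : IsSimplePolytope (convexHull ℝ (W : Set (Fin n → ℝ)))) {v : Fin n → ℝ}
    (hv : v ∈ convexHull ℝ (W : Set (Fin n → ℝ)))
    (hsep : SeparatesVectors
      (activeConstraints (finite_facetNormals W p).toFinset (fun l => 1 + l p) v)) :
    (activeConstraints (finite_facetNormals W p).toFinset (fun l => 1 + l p) v).card =
      Module.finrank ℝ (Fin n → ℝ) := by
  have : Nonempty (Fin n) := ⟨⟨0, hn⟩⟩
  have hΦ := isHalfspacePresentation_facetNormals hp
  set P := convexHull ℝ (W : Set (Fin n → ℝ))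
  set A := activeConstraints (finite_facetNormals W p).toFinset (fun l => 1 + l p) v with hA
  have hAmem : ∀ l, l ∈ A ↔ l ∈ facetNormals W p ∧ l v = 1 + l p := fun l => by
    rw [hA, mem_activeConstraints, Set.Finite.mem_toFinset]
  have hface : IsFaceOfDim P {v} 0 := by
    refine ⟨Set.singleton_nonempty v, ?_, ?_⟩
    · rw [← tightFace_active_eq_singleton hv hsep]
      exact hΦ.isExposed_tightFace (Finset.filter_subset _ _)
    · rw [direction_affineSpan, vectorSpan_singleton, finrank_bot]
  have hset : {F | IsFaceOfDim P F (n - 1) ∧ {v} ⊆ F} =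
      (fun l => tightFace P (fun l => 1 + l p) {l}) '' (A : Set (StrongDual ℝ (Fin n → ℝ))) := by
    ext F
    constructor
    · rintro ⟨⟨hne, hF, hdim⟩, hvF⟩
      obtain ⟨l, hl, rfl⟩ := exists_facetNormal_of_finrank hp hne hF
        (by rw [hdim, Module.finrank_fin_fun]; omega)
      exact ⟨l, (hAmem l).2 ⟨hl, (hvF rfl).2 l (Finset.mem_singleton_self _)⟩, rfl⟩
    · rintro ⟨l, hl, rfl⟩
      obtain ⟨hlN, hlv⟩ := (hAmem l).1 hl
      have hvF : v ∈ tightFace P (fun l => 1 + l p) {l} :=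
        ⟨hv, fun k hk => by rw [Finset.mem_singleton.1 hk]; exact hlv⟩
      refine ⟨⟨⟨v, hvF⟩, ?_, ?_⟩, Set.singleton_subset_iff.2 hvF⟩
      · exact hΦ.isExposed_tightFace
          (Finset.singleton_subset_iff.2 ((finite_facetNormals W p).mem_toFinset.2 hlN))
      · have := finrank_direction_of_mem_facetNormals hlN
        rw [Module.finrank_fin_fun] at this
        exact Nat.eq_sub_of_add_eq this
  have h := hsimple {v} hface
  rw [hset, Set.InjOn.ncard_image (tightFace_singleton_injOn.mono fun l hl =>
    ((hAmem l).1 hl).1), Set.ncard_coe_finset] at h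
  rw [h, Module.finrank_fin_fun]

end LatticePolytope

/-- Let `P ⊂ ℝ^n` be an `n`-dimensional simple lattice polytope of degree
`d = n + 1 - cd(P)` with `d < n`.  If `d ≥ n - d`, then
`∑_{j=0}^n (-1)^j ∑_{F ∈ F(P)_j} ((n-d)·h*_{n-d}(F) + (j+1)·∑_{k=0}^{n-d-1} h*_k(F)) = 0`. -/
theorem simple_high_degree_hstar_relation {n d : ℕ} (P : Set (Fin n → ℝ))
    (hP : IsLatticePolytope P) (hfull : affineSpan ℝ P = ⊤)
    (hsimple : IsSimplePolytope P)
    (hstar : Set (Fin n → ℝ) → ℕ → ℤ)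
    (hhstar : ∀ (j : ℕ) (F : Set (Fin n → ℝ)), IsFaceOfDim P F j →
      IsHStarOfDim F j (hstar F))
    (hdeg : d + cd P = n + 1) (hdn : d < n) (hge : n - d ≤ d) :
    ∑ j ∈ Finset.range (n + 1), (-1 : ℤ) ^ j *
      ∑ᶠ F ∈ {F | IsFaceOfDim P F j},
        (((n - d : ℕ) : ℤ) * hstar F (n - d) +
          ((j : ℤ) + 1) * ∑ k ∈ Finset.range (n - d), hstar F k) = 0 := by
  classical
  obtain ⟨V, hPV⟩ := hP
  have hPW : P = convexHull ℝ ((V.image latt : Finset (Fin n → ℝ)) : Set (Fin n → ℝ)) := by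
    rw [hPV, Finset.coe_image]
  obtain ⟨p, hp⟩ := (hPV ▸ convex_convexHull ℝ _ :
    Convex ℝ P).interior_nonempty_iff_affineSpan_eq_top.2 hfull
  set Φ := (finite_facetNormals (V.image latt) p).toFinset
  set b : StrongDual ℝ (Fin n → ℝ) → ℝ := fun l => 1 + l p
  have hΦ : IsHalfspacePresentation P Φ b := by
    rw [hPW] at hp ⊢
    exact isHalfspacePresentation_facetNormals hp
  have hcard : ∀ v ∈ P, SeparatesVectors (activeConstraints Φ b v) →
      (activeConstraints Φ b v).card = Module.finrank ℝ (Fin n → ℝ) := by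
    rw [hPW] at hp hsimple ⊢
    exact fun v hv hsep => hsimple.card_active_eq (by omega) hp hv hsep
  set 𝓕 := (hΦ.finite_exposed hcard).toFinset
  have h𝓕 : ∀ F, F ∈ 𝓕 ↔ F.Nonempty ∧ IsExposed ℝ P F := fun F => Set.Finite.mem_toFinset _
  set δ : Set (Fin n → ℝ) → ℕ := fun F => Module.finrank ℝ (affineSpan ℝ F).direction
  have hδ : ∀ F, δ F ≤ n := fun F => by
    simpa using Submodule.finrank_le (affineSpan ℝ F).direction
  set c := n - d
  have hgroup : ∀ j ∈ Finset.range (n + 1), (-1 : ℤ) ^ j * ∑ᶠ F ∈ {F | IsFaceOfDim P F j},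
      ((c : ℤ) * hstar F c + ((j : ℤ) + 1) * ∑ k ∈ Finset.range c, hstar F k) =
      ∑ F ∈ 𝓕 with δ F = j, (-1 : ℤ) ^ δ F *
        ((c : ℤ) * hstar F c + ((δ F : ℤ) + 1) * ∑ k ∈ Finset.range c, hstar F k) := by
    intro j _
    have hset : {F | IsFaceOfDim P F j} =
        ((𝓕.filter (δ · = j) : Finset _) : Set (Set (Fin n → ℝ))) := by
      ext F
      rw [Finset.mem_coe, Finset.mem_filter, h𝓕, and_assoc]
      rfl
    rw [hset, finsum_mem_coe_finset, Finset.mul_sum]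
    refine Finset.sum_congr rfl fun F hF => ?_
    rw [(Finset.mem_filter.1 hF).2]
  rw [Finset.sum_congr rfl hgroup, Finset.sum_fiberwise_of_maps_to fun F _ =>
    Finset.mem_range.2 (Nat.lt_succ_of_le (hδ F))]
  have hweight : ∀ F ∈ 𝓕, (-1 : ℤ) ^ δ F *
      ((c : ℤ) * hstar F c + ((δ F : ℤ) + 1) * ∑ k ∈ Finset.range c, hstar F k) =
      ∑ q ∈ Finset.HasAntidiagonal.antidiagonal c, (-1) ^ q.1 * (q.2 : ℤ) *
        ((-1 : ℤ) ^ δ F * ((δ F + 1).choose q.1 : ℤ) * lattCount F q.2) := by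
    intro F hF
    obtain ⟨hzero, hcount⟩ := hhstar (δ F) F ⟨((h𝓕 F).1 hF).1, ((h𝓕 F).1 hF).2, rfl⟩
    rw [hstar_weight_eq hzero hcount c, Finset.mul_sum]
    exact Finset.sum_congr rfl fun q _ => by ring
  rw [Finset.sum_congr rfl hweight, Finset.sum_comm]
  refine Finset.sum_eq_zero fun q hq => ?_
  rw [← Finset.mul_sum]
  rcases Nat.eq_zero_or_pos q.2 with hm | hm
  · rw [hm]
    simp
  refine mul_eq_zero_of_right _ ?_
  rw [Finset.HasAntidiagonal.mem_antidiagonal] at hq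
  have hm0 : (q.2 : ℝ) ≠ 0 := by exact_mod_cast hm.ne'
  set X := (finite_setOf_latt_mem (hΦ.isBounded.smul₀ (q.2 : ℝ))).toFinset
  have hX : ∀ x, x ∈ X ↔ latt x ∈ (q.2 : ℝ) • P := fun x => Set.Finite.mem_toFinset _
  have hsum : ∀ F ∈ 𝓕, (-1 : ℤ) ^ δ F * ((δ F + 1).choose q.1 : ℤ) * lattCount F q.2 =
      ∑ x ∈ X, if (q.2 : ℝ)⁻¹ • latt x ∈ F then
        (-1 : ℤ) ^ δ F * ((δ F + 1).choose q.1 : ℤ) else 0 := fun F hF => by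
    rw [lattCount_eq_sum ((h𝓕 F).1 hF).2.subset hm hX, Finset.mul_sum]
    simp only [mul_ite, mul_one, mul_zero]
  rw [Finset.sum_congr rfl hsum, Finset.sum_comm]
  refine Finset.sum_eq_zero fun x hx => ?_
  rw [← Finset.sum_filter]
  have hy : (q.2 : ℝ)⁻¹ • latt x ∈ P :=
    (Set.mem_smul_set_iff_inv_smul_mem₀ hm0 _ _).1 ((hX x).1 hx)
  have hpb : ∀ l ∈ Φ, l p < b l := fun l _ => by simp [b]
  have hcd := hΦ.cd_le_add_card_active hPV (interior_subset hp) hpb hm hy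
    (smul_inv_smul₀ hm0 (latt x)).symm
  exact hΦ.sum_exposed_through_eq_zero hcard h𝓕 hy (by omega)
end
end

section
/- Let n, d, j, k be integers with 0 ≤ d ≤ n, 0 ≤ k ≤ d, and k ≤ j ≤ n. If k = n − d, then Σ_{i=0}^{n−d} (−1)^{n−d−i} · i · C(i+j−k, j) · C(j+1, n−d−i) = n − d. -/
/-- For natural numbers `0 ≤ d ≤ n`, `0 ≤ k ≤ d`, `k ≤ j ≤ n` with
`k = n - d`, one has
`∑_{i=0}^{n-d} (-1)^{n-d-i} · i · C(i+j-k, j) · C(j+1, n-d-i) = n - d`. -/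
theorem key_binomial_identity_middle_k (n d j k : ℕ)
    (hdn : d ≤ n) (hkd : k ≤ d) (hkj : k ≤ j) (hjn : j ≤ n)
    (hk : k = n - d) :
    ∑ i ∈ Finset.range (n - d + 1),
        (-1 : ℤ) ^ (n - d - i) * i * ((i + j - k).choose j) * ((j + 1).choose (n - d - i))
      = ((n - d : ℕ) : ℤ) := by
  subst hk
  rw [Finset.sum_range_succ, Finset.sum_eq_zero]
  · simp
  · intro i hi
    have hlt : i + j - (n - d) < j := by
      have := Finset.mem_range.mp hi
      omega
    simp [Nat.choose_eq_zero_of_lt hlt]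
end

section
/- Fix integers a ≥ 1 and j ≥ 0, and for an integer k with 0 ≤ k define f(k) := Σ_{i=0}^{a} (−1)^{a−i} · i · C(i+j−k, j) · C(j+1, a−i), where C(x, j) = 0 whenever 0 ≤ x < j. Then for every integer k with 0 ≤ k ≤ j and k ∉ {a−1, a}, one has f(k+1) = f(k). -/
open PowerSeries in
theorem coeff_one_sub_X_pow_int (d n : ℕ) :
    coeff n ((1 - X : ℤ⟦X⟧) ^ d) = (-1) ^ n * (d.choose n : ℤ) := by
  have h : (1 - X : ℤ⟦X⟧) ^ d = rescale (-1 : ℤ) (((1 + Polynomial.X : Polynomial ℤ) ^ d :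
      Polynomial ℤ) : ℤ⟦X⟧) := by
    simp [sub_eq_add_neg]
  rw [h, coeff_rescale, Polynomial.coeff_coe, Polynomial.coeff_one_add_X_pow]

open PowerSeries in
/-- The generating function of `i * C(i + j - k, j)`. -/
theorem mk_mul_choose_sub (j k : ℕ) (hk : k ≤ j + 1) :
    (mk fun i => (i : ℤ) * ((i + j - k).choose j : ℤ)) =
      X ^ k * (C (k : ℤ) * mk 1 ^ (j + 1) + C (j + 1 : ℤ) * (X * mk 1 ^ (j + 2))) := by
  ext i
  rw [coeff_mk, coeff_X_pow_mul']
  split_ifs with h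
  · obtain ⟨m, rfl⟩ := Nat.exists_eq_add_of_le h
    rw [mk_one_pow_eq_mk_choose_add, mk_one_pow_eq_mk_choose_add,
      show k + m + j - k = j + m by omega, show k + m - k = m by omega,
      map_add, coeff_C_mul, coeff_C_mul, coeff_mk]
    rcases m with _ | m
    · simp
    · rw [coeff_succ_X_mul, coeff_mk]
      have h1 := Nat.choose_succ_right_eq (j + (m + 1)) j
      rw [show j + (m + 1) - j = m + 1 by omega] at h1
      rw [show j + 1 + m = j + (m + 1) by omega]
      zify at h1
      push_cast
      linear_combination -h1
  · rcases Nat.eq_zero_or_pos i with rfl | hi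
    · simp
    · rw [Nat.choose_eq_zero_of_lt (by omega)]
      simp

open PowerSeries in
theorem sum_mul_choose_sub_mul_choose (a j k : ℕ) (hk : k ≤ j + 1) :
    ∑ i ∈ Finset.range (a + 1),
        (-1 : ℤ) ^ (a - i) * i * ((i + j - k).choose j) * ((j + 1).choose (a - i)) =
      (if a = k then (k : ℤ) else 0) + (if k < a then (j + 1 : ℤ) else 0) := by
  have hinv : (mk 1 : ℤ⟦X⟧) * (1 - X) = 1 := mk_one_mul_one_sub_eq_one ℤ
  have hprod : (mk fun i => (i : ℤ) * ((i + j - k).choose j : ℤ)) * (1 - X) ^ (j + 1) =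
      C (k : ℤ) * X ^ k + C (j + 1 : ℤ) * (X ^ (k + 1) * mk 1) := by
    have hpow : (mk 1 : ℤ⟦X⟧) ^ (j + 1) * (1 - X) ^ (j + 1) = 1 := by
      rw [← mul_pow, hinv, one_pow]
    rw [mk_mul_choose_sub j k hk]
    linear_combination
      (C (k : ℤ) * X ^ k + C (j + 1 : ℤ) * (X ^ (k + 1) * mk 1)) * hpow
  have hcoeff := congrArg (coeff a) hprod
  rw [coeff_mul, Finset.Nat.sum_antidiagonal_eq_sum_range_succ_mk, map_add, coeff_C_mul,
    coeff_C_mul, coeff_X_pow, coeff_X_pow_mul'] at hcoeff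
  simp only [coeff_mk, coeff_one_sub_X_pow_int, Pi.one_apply, mul_ite, mul_one, mul_zero,
    Nat.succ_le_iff] at hcoeff
  rw [← hcoeff]
  exact Finset.sum_congr rfl fun i _ => by ring


/-- Fix `a ≥ 1` and `j ≥ 0`, and for `0 ≤ k` let
`f(k) = ∑_{i=0}^{a} (-1)^{a-i} · i · C(i+j-k, j) · C(j+1, a-i)` (where `C(x, j) = 0`
whenever `0 ≤ x < j`).  Then for every `k` with `0 ≤ k ≤ j` and `k ∉ {a-1, a}` one has
`f(k+1) = f(k)`. -/
theorem f_recurrence (a j k : ℕ) (ha : 1 ≤ a) (hkj : k ≤ j)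
    (hk1 : k ≠ a - 1) (hk2 : k ≠ a) :
    ∑ i ∈ Finset.range (a + 1),
        (-1 : ℤ) ^ (a - i) * i * ((i + j - (k + 1)).choose j) * ((j + 1).choose (a - i))
      = ∑ i ∈ Finset.range (a + 1),
        (-1 : ℤ) ^ (a - i) * i * ((i + j - k).choose j) * ((j + 1).choose (a - i)) := by
  rw [sum_mul_choose_sub_mul_choose a j (k + 1) (by omega),
    sum_mul_choose_sub_mul_choose a j k (by omega),
    if_neg (show a ≠ k + 1 by omega), if_neg (show a ≠ k by omega)]
  congr 1
  exact if_congr (by omega) rfl rfl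
end

section
/- Let P ⊂ ℝ^n be an n-dimensional lattice simplex. Then c(P) ≥ 0. -/
open scoped Pointwise
open MeasureTheory

noncomputable section

/-- `φ : ℝ^j → ℝ^n` is an affine parametrization of the affine hull of `F` mapping the
lattice `ℤ^j` bijectively onto `aff(F) ∩ ℤ^n`.  Pulling `F` back by such a `φ` computes
volumes with respect to the lattice `aff(F) ∩ ℤ^n`. -/
def IsUnimodularParam {n j : ℕ} (F : Set (Fin n → ℝ))
    (φ : (Fin j → ℝ) →ᵃ[ℝ] (Fin n → ℝ)) : Prop :=
  Function.Injective φ ∧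
    Set.range φ = (affineSpan ℝ F : Set (Fin n → ℝ)) ∧
    ∀ x : Fin j → ℝ, (∃ w : Fin j → ℤ, x = latt w) ↔ ∃ z : Fin n → ℤ, φ x = latt z

open Finset in
/-- The alternating sum of the cardinalities of all supersets of `A` is nonnegative. -/
theorem alternating_sum_card_superset_nonneg {α : Type*} [Fintype α] [DecidableEq α]
    (A : Finset α) :
    0 ≤ ∑ S with A ⊆ S, (-1 : ℝ) ^ (Fintype.card α - #S) * #S := by
  have hfilter : (univ.filter fun S => A ⊆ S) = Aᶜ.powerset.image (A ∪ ·) := by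
    rw [compl_eq_univ_sdiff, ← Icc_eq_image_powerset (subset_univ A)]
    ext S
    simp
  have hcard : Fintype.card α = #A + #Aᶜ := (card_add_card_compl A).symm
  have hunion : ∀ T ⊆ Aᶜ, #(A ∪ T) = #A + #T := fun T hT =>
    card_union_of_disjoint (disjoint_of_subset_right hT disjoint_compl_right)
  rw [hfilter, sum_image]
  swap
  · intro T hT T' hT' h
    have hT : T ⊆ Aᶜ := mem_powerset.1 (mem_coe.1 hT)
    have hT' : T' ⊆ Aᶜ := mem_powerset.1 (mem_coe.1 hT')
    have key : ∀ U ⊆ Aᶜ, (A ∪ U) ∩ Aᶜ = U := fun U hU => by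
      rw [union_inter_distrib_right, inter_compl, empty_union, inter_eq_left.2 hU]
    rw [← key T hT, ← key T' hT']
    exact congrArg (· ∩ Aᶜ) h
  have hsum : ∑ T ∈ Aᶜ.powerset, (-1 : ℝ) ^ (Fintype.card α - #(A ∪ T)) * #(A ∪ T)
      = ∑ T ∈ Aᶜ.powerset, (-1 : ℝ) ^ (#Aᶜ - #T) * (#A + #T) := by
    refine sum_congr rfl fun T hT => ?_
    rw [hunion T (mem_powerset.1 hT), hcard, Nat.add_sub_add_left]
    push_cast
    rfl
  rw [hsum]
  rcases Aᶜ.eq_empty_or_nonempty with h | ⟨p, hp⟩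
  · simp [h]
  rw [← insert_erase hp]
  set C := Aᶜ.erase p
  have hpC : p ∉ C := notMem_erase p _
  rw [sum_powerset_insert hpC, ← sum_add_distrib, card_insert_of_notMem hpC]
  have hterm : ∀ T ∈ C.powerset,
      (-1 : ℝ) ^ (#C + 1 - #T) * (#A + #T)
        + (-1 : ℝ) ^ (#C + 1 - #(insert p T)) * (#A + #(insert p T))
      = (1 : ℝ) ^ #T * (-1) ^ (#C - #T) := by
    intro T hT
    have hTC := mem_powerset.1 hT
    rw [card_insert_of_notMem fun h => hpC (hTC h), Nat.add_sub_add_right,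
      Nat.succ_sub (card_le_card hTC), pow_succ]
    push_cast
    ring
  rw [sum_congr rfl hterm, sum_pow_mul_eq_add_pow]
  norm_num

open Finset in
/-- The weighted alternating count of elements supported in faces is nonnegative. -/
theorem alternating_sum_card_filter_support_nonneg {β : Type*} {n : ℕ} (B : Finset β)
    (supp : β → Finset (Fin (n + 1))) :
    0 ≤ ∑ j ∈ range (n + 1), (-1 : ℝ) ^ (n - j) * (j + 1) *
      ∑ S ∈ powersetCard (j + 1) univ, (#{g ∈ B | supp g ⊆ S} : ℝ) := by
  have h : ∑ j ∈ range (n + 1), (-1 : ℝ) ^ (n - j) * (j + 1) *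
      ∑ S ∈ powersetCard (j + 1) univ, (#{g ∈ B | supp g ⊆ S} : ℝ)
      = ∑ g ∈ B, ∑ S with supp g ⊆ S,
        (-1 : ℝ) ^ (Fintype.card (Fin (n + 1)) - #S) * #S := by
    simp_rw [sum_filter]
    rw [sum_comm]
    have h1 : ∀ S : Finset (Fin (n + 1)), ∑ g ∈ B, (if supp g ⊆ S then
        (-1 : ℝ) ^ (Fintype.card (Fin (n + 1)) - #S) * #S else 0)
        = (-1 : ℝ) ^ (n + 1 - #S) * #S * #{g ∈ B | supp g ⊆ S} := by
      intro S
      rw [← sum_filter, sum_const, nsmul_eq_mul, Fintype.card_fin]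
      ring
    simp_rw [h1]
    rw [← powerset_univ, sum_powerset, Finset.card_univ, Fintype.card_fin, 
      sum_range_succ' _ (n + 1)]
    simp only [powersetCard_zero, sum_singleton, card_empty, Nat.cast_zero, mul_zero, zero_mul,
      add_zero]
    refine sum_congr rfl fun j _ => ?_
    rw [mul_sum]
    refine sum_congr rfl fun S hS => ?_
    rw [(mem_powersetCard.1 hS).2, Nat.add_sub_add_right]
    push_cast
    ring
  rw [h]
  exact sum_nonneg fun g _ => alternating_sum_card_superset_nonneg (supp g)

/-- The standard corner simplex of size `t` in `ℝ^k`. -/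
def cornerSimplex (k : ℕ) (t : ℝ) : Set (Fin k → ℝ) := {x | (∀ i, 0 ≤ x i) ∧ ∑ i, x i ≤ t}

theorem isClosed_cornerSimplex (k : ℕ) (t : ℝ) : IsClosed (cornerSimplex k t) := by
  have h : cornerSimplex k t = (⋂ i, {x | 0 ≤ x i}) ∩ {x | ∑ i, x i ≤ t} := by
    ext x
    simp [cornerSimplex]
  rw [h]
  exact (isClosed_iInter fun i => isClosed_le continuous_const (continuous_apply i)).inter
    (isClosed_le (by fun_prop) continuous_const)

theorem volume_cornerSimplex (k : ℕ) {t : ℝ} (ht : 0 ≤ t) :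
    volume (cornerSimplex k t) = ENNReal.ofReal (t ^ k / k.factorial) := by
  induction k generalizing t with
  | zero =>
    have : cornerSimplex 0 t = Set.univ := by
      ext x; simp [cornerSimplex, ht]
    simp [this, volume_pi]
  | succ k ih =>
    have hmp := (volume_preserving_piFinSuccAbove (fun _ : Fin (k + 1) => ℝ) 0).symm
    rw [← hmp.measure_preimage (isClosed_cornerSimplex _ _).measurableSet.nullMeasurableSet,
      Measure.volume_eq_prod, Measure.prod_apply
        (hmp.measurable (isClosed_cornerSimplex _ _).measurableSet)]
    have hslice : ∀ a : ℝ, volume (Prod.mk a ⁻¹'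
        ((MeasurableEquiv.piFinSuccAbove (fun _ : Fin (k + 1) => ℝ) 0).symm ⁻¹'
          cornerSimplex (k + 1) t))
        = (Set.Icc 0 t).indicator
          (fun a => ENNReal.ofReal ((t - a) ^ k / k.factorial)) a := by
      intro a
      have hset : Prod.mk a ⁻¹'
          ((MeasurableEquiv.piFinSuccAbove (fun _ : Fin (k + 1) => ℝ) 0).symm ⁻¹'
            cornerSimplex (k + 1) t) = {x | 0 ≤ a ∧ x ∈ cornerSimplex k (t - a)} := by
        ext x
        simp only [cornerSimplex, MeasurableEquiv.piFinSuccAbove, Set.mem_preimage,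
          Set.mem_ofPred_eq, Fin.forall_fin_succ, Fin.sum_univ_succ]
        simp [Fin.insertNthEquiv, and_assoc, le_sub_iff_add_le']
      rw [hset]
      by_cases ha : a ∈ Set.Icc 0 t
      · rw [Set.indicator_of_mem ha, ← ih (sub_nonneg.2 ha.2)]
        congr 1
        ext x
        simp [ha.1]
      · rw [Set.indicator_of_notMem ha]
        have : {x | 0 ≤ a ∧ x ∈ cornerSimplex k (t - a)} = ∅ := by
          ext x
          simp only [Set.mem_ofPred_eq, Set.mem_empty_iff_false, iff_false, not_and]
          rintro h0 ⟨hx, hs⟩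
          have := Finset.sum_nonneg fun i (_ : i ∈ Finset.univ) => hx i
          exact ha ⟨h0, by linarith⟩
        rw [this, measure_empty]
    simp_rw [hslice]
    rw [lintegral_indicator measurableSet_Icc, ← ofReal_integral_eq_lintegral_ofReal]
    · rw [integral_Icc_eq_integral_Ioc, ← intervalIntegral.integral_of_le ht,
        intervalIntegral.integral_div,
        intervalIntegral.integral_comp_sub_left (fun x => x ^ k) t]
      simp only [sub_self, sub_zero, integral_pow, Nat.factorial_succ]
      congr 1
      push_cast
      have : (k.factorial : ℝ) ≠ 0 := by positivity
      field_simp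
      simp
    · exact (by fun_prop : Continuous fun a : ℝ => (t - a) ^ k / (k.factorial : ℝ))
        |>.continuousOn.integrableOn_Icc
    · refine (ae_restrict_iff' measurableSet_Icc).2 (.of_forall fun a ha => ?_)
      have := sub_nonneg.2 ha.2
      simp only [Pi.zero_apply]
      positivity

theorem latt_mulVec {m k : Type*} [Fintype k] (A : Matrix m k ℤ) (y : k → ℤ) :
    latt (A.mulVec y) = (A.map (Int.cast : ℤ → ℝ)).mulVec (latt y) := by
  ext i
  simp [latt, Matrix.mulVec, dotProduct]

theorem latt_injective {ι : Type*} : Function.Injective (latt : (ι → ℤ) → ι → ℝ) := by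
  intro x y h
  ext i
  exact Int.cast_injective (α := ℝ) (congrFun h i)

theorem latt_sub {ι : Type*} (x y : ι → ℤ) : latt (x - y) = latt x - latt y := by
  ext i
  simp [latt]

theorem latt_zsmul {ι : Type*} (k : ℤ) (x : ι → ℤ) : latt (k • x) = (k : ℝ) • latt x := by
  ext i
  simp [latt]

/-- The points of the half-open unit cube mapped to lattice points by the matrix `A`. -/
def cubePreimage {k : ℕ} (A : Matrix (Fin k) (Fin k) ℤ) : Set (Fin k → ℝ) :=
  {x | (∀ i, x i ∈ Set.Ico (0 : ℝ) 1) ∧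
    ∃ w : Fin k → ℤ, (A.map (Int.cast : ℤ → ℝ)).mulVec x = latt w}

theorem finite_cubePreimage_and_ncard {k : ℕ} (A : Matrix (Fin k) (Fin k) ℤ) (hA : A.det ≠ 0) :
    (cubePreimage A).Finite ∧ (cubePreimage A).ncard = A.det.natAbs := by
  set B := A.map (Int.cast : ℤ → ℝ) with hB
  have hdet : IsUnit B.det := by
    have : B.det = (A.det : ℝ) := ((Int.castRingHom ℝ).map_det A).symm
    rw [this]
    exact (Int.cast_ne_zero.2 hA).isUnit
  have hBinj : Function.Injective B.mulVec :=
    Matrix.mulVec_injective_iff_isUnit.2 ((Matrix.isUnit_iff_isUnit_det _).2 hdet)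
  have hinj : Function.Injective A.toLin' := by
    intro x y h
    apply latt_injective
    apply hBinj
    rw [← latt_mulVec, ← latt_mulVec]
    exact congrArg latt h
  set N := LinearMap.range A.toLin'
  have hcard : A.det.natAbs = Nat.card ((Fin k → ℤ) ⧸ N) := by
    rw [← Submodule.natAbs_det_equiv N (LinearEquiv.ofInjective A.toLin' hinj)]
    congr 1
    rw [← LinearMap.det_toLin']
    rfl
  choose w hw using fun x : cubePreimage A => x.2.2
  have hbij : Function.Bijective fun x : cubePreimage A =>
      (Submodule.Quotient.mk (w x) : _ ⧸ N) := by
    constructor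
    · intro x x' h
      obtain ⟨y, hy⟩ := (Submodule.Quotient.eq N).1 h
      have hy' : (x : Fin k → ℝ) - x' = latt y := by
        apply hBinj
        rw [Matrix.mulVec_sub, hw, hw, ← latt_sub, ← latt_mulVec, ← hy]
        rfl
      ext i
      have hi : x.1 i - x'.1 i = y i := congrFun hy' i
      have h1 := x.2.1 i
      have h2 := x'.2.1 i
      have hlt : (y i : ℝ) < 1 := by linarith [h1.2, h2.1]
      have hgt : (-1 : ℝ) < y i := by linarith [h1.1, h2.2]
      have : y i = 0 := by
        have hlt' : y i < 1 := by exact_mod_cast hlt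
        have hgt' : -1 < y i := by exact_mod_cast hgt
        omega
      rw [this] at hi
      push_cast at hi
      linarith
    · intro q
      obtain ⟨z, rfl⟩ := Submodule.Quotient.mk_surjective N q
      set y := B⁻¹.mulVec (latt z) with hy
      have hBy : B.mulVec y = latt z := by
        rw [hy, Matrix.mulVec_mulVec, Matrix.mul_nonsing_inv _ hdet, Matrix.one_mulVec]
      set f : Fin k → ℤ := fun i => ⌊y i⌋
      have hx : (fun i => Int.fract (y i)) = y - latt f := rfl
      have hBx : B.mulVec (fun i => Int.fract (y i)) = latt (z - A.mulVec f) := by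
        rw [hx, Matrix.mulVec_sub, hBy, latt_sub, latt_mulVec]
      refine ⟨⟨fun i => Int.fract (y i), fun i => ⟨Int.fract_nonneg _, Int.fract_lt_one _⟩,
        _, hBx⟩, ?_⟩
      refine (Submodule.Quotient.eq N).2 ⟨-f, ?_⟩
      rw [latt_injective ((hw _).symm.trans hBx)]
      simp [Matrix.mulVec_neg]
  have hc := Nat.card_eq_of_bijective _ hbij
  refine ⟨?_, ?_⟩
  · exact @Set.toFinite _ _ (Nat.finite_of_card_ne_zero (by rw [hc, ← hcard]; simpa using hA))
  · rw [hcard, ← hc]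
    rfl

theorem mem_convexHull_image_iff_exists_weights {ι E : Type*} [Fintype ι] [AddCommGroup E]
    [Module ℝ E] (p : ι → E) (S : Finset ι) (x : E) :
    x ∈ convexHull ℝ (p '' S) ↔
      ∃ c : ι → ℝ, (∀ i, 0 ≤ c i) ∧ ∑ i, c i = 1 ∧ (∀ i ∉ S, c i = 0) ∧ x = ∑ i, c i • p i := by
  classical
  constructor
  · intro hx
    refine convexHull_min (t := {x | ∃ c : ι → ℝ, (∀ i, 0 ≤ c i) ∧ ∑ i, c i = 1 ∧
      (∀ i ∉ S, c i = 0) ∧ x = ∑ i, c i • p i}) ?_ ?_ hx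
    · rintro _ ⟨i, hi, rfl⟩
      refine ⟨Pi.single i 1, fun k => ?_, by simp, fun k hk => ?_, ?_⟩
      · rw [Pi.single_apply]
        split_ifs <;> norm_num
      · exact Pi.single_eq_of_ne (fun h => hk (by rw [h]; exact hi)) _
      · simp [Pi.single_apply]
    · rintro _ ⟨c, hc0, hc1, hcS, rfl⟩ _ ⟨d, hd0, hd1, hdS, rfl⟩ a b ha hb hab
      refine ⟨a • c + b • d, fun i => ?_, ?_, fun i hi => ?_, ?_⟩
      · have := hc0 i
        have := hd0 i
        simp only [Pi.add_apply, Pi.smul_apply, smul_eq_mul]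
        positivity
      · simp only [Pi.add_apply, Pi.smul_apply, smul_eq_mul, Finset.sum_add_distrib,
          ← Finset.mul_sum, hc1, hd1, mul_one, hab]
      · simp [hcS i hi, hdS i hi]
      · simp only [Pi.add_apply, Pi.smul_apply, smul_eq_mul, add_smul, Finset.sum_add_distrib,
          mul_smul, ← Finset.smul_sum]
  · rintro ⟨c, hc0, hc1, hcS, rfl⟩
    rw [← Finset.sum_subset (Finset.subset_univ S) fun i _ hi => by rw [hcS i hi, zero_smul]]
    refine (convex_convexHull ℝ _).sum_mem (fun i _ => hc0 i) ?_ fun i hi =>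
      subset_convexHull ℝ _ ⟨i, hi, rfl⟩
    rw [← hc1]
    exact Finset.sum_subset (Finset.subset_univ S) fun i _ hi => hcS i hi

/-- The maximizers of a linear functional on the convex hull of finitely many points are the convex
hull of the maximizing points. -/
theorem setOf_isMax_convexHull_range {ι E : Type*} [Fintype ι] [AddCommGroup E] [Module ℝ E]
    (p : ι → E) (l : E →ₗ[ℝ] ℝ) (M : ℝ) (S : Finset ι) (hS : S.Nonempty)
    (hle : ∀ i, l (p i) ≤ M) (hiff : ∀ i, i ∈ S ↔ l (p i) = M) :
    {x ∈ convexHull ℝ (Set.range p) | ∀ y ∈ convexHull ℝ (Set.range p), l y ≤ l x}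
      = convexHull ℝ (p '' S) := by
  have hrange : Set.range p = p '' (Finset.univ : Finset ι) := by simp
  have hl : ∀ c : ι → ℝ, ∑ i, c i = 1 → M - l (∑ i, c i • p i) = ∑ i, c i * (M - l (p i)) := by
    intro c hc
    simp only [map_sum, map_smul, smul_eq_mul, mul_sub, Finset.sum_sub_distrib, ← Finset.sum_mul,
      hc, one_mul]
  ext x
  rw [mem_convexHull_image_iff_exists_weights]
  constructor
  · rintro ⟨hx, hmax⟩
    rw [hrange, mem_convexHull_image_iff_exists_weights] at hx
    obtain ⟨c, hc0, hc1, -, rfl⟩ := hx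
    refine ⟨c, hc0, hc1, fun i hi => ?_, rfl⟩
    obtain ⟨k, hk⟩ := hS
    have h1 := hmax (p k) (subset_convexHull ℝ _ ⟨k, rfl⟩)
    rw [(hiff k).1 hk] at h1
    have h2 : ∀ i ∈ Finset.univ, 0 ≤ c i * (M - l (p i)) := fun i _ =>
      mul_nonneg (hc0 i) (sub_nonneg.2 (hle i))
    have h3 : ∑ i, c i * (M - l (p i)) = 0 :=
      le_antisymm (by rw [← hl c hc1]; linarith) (Finset.sum_nonneg h2)
    have h4 := (Finset.sum_eq_zero_iff_of_nonneg h2).1 h3 i (Finset.mem_univ i)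
    exact (mul_eq_zero.1 h4).resolve_right fun h => hi ((hiff i).2 (by linarith))
  · rintro ⟨c, hc0, hc1, hcS, rfl⟩
    refine ⟨?_, fun y hy => ?_⟩
    · rw [hrange, mem_convexHull_image_iff_exists_weights]
      exact ⟨c, hc0, hc1, by simp, rfl⟩
    · rw [hrange, mem_convexHull_image_iff_exists_weights] at hy
      obtain ⟨d, hd0, hd1, -, rfl⟩ := hy
      have h1 : 0 ≤ M - l (∑ i, d i • p i) := by
        rw [hl d hd1]
        exact Finset.sum_nonneg fun i _ => mul_nonneg (hd0 i) (sub_nonneg.2 (hle i))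
      have h2 : M - l (∑ i, c i • p i) = 0 := by
        rw [hl c hc1]
        refine Finset.sum_eq_zero fun i _ => ?_
        by_cases hi : i ∈ S
        · rw [(hiff i).1 hi, sub_self, mul_zero]
        · rw [hcS i hi, zero_mul]
      linarith

/-- Every set of vertices of a full-dimensional simplex is the set of maximizing vertices of some
linear functional. -/
theorem exists_linearMap_max_on_finset {ι E : Type*} [Fintype ι] [AddCommGroup E] [Module ℝ E]
    {p : ι → E} (hind : AffineIndependent ℝ p) (htop : affineSpan ℝ (Set.range p) = ⊤)
    (S : Finset ι) :
    ∃ (l : E →ₗ[ℝ] ℝ) (M : ℝ), (∀ i, l (p i) ≤ M) ∧ ∀ i, i ∈ S ↔ l (p i) = M := by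
  classical
  let b : AffineBasis ι ℝ E := ⟨p, hind, htop⟩
  have hcoord : ∀ i k, (b.coord k).linear (p i) = (if k = i then 1 else 0) - b.coord k 0 := by
    intro i k
    have h := (b.coord k).linearMap_vsub (p i) 0
    have hb : b.coord k (p i) = if k = i then 1 else 0 := b.coord_apply k i
    simpa [hb] using h
  have hval : ∀ i, (∑ k ∈ S, (b.coord k).linear) (p i)
      = (if i ∈ S then 1 else 0) - ∑ k ∈ S, b.coord k 0 := by
    intro i
    simp only [LinearMap.sum_apply, hcoord, Finset.sum_sub_distrib, Finset.sum_ite_eq']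
  refine ⟨∑ k ∈ S, (b.coord k).linear, 1 - ∑ k ∈ S, b.coord k 0, fun i => ?_, fun i => ?_⟩
  · rw [hval]
    split_ifs <;> linarith
  · rw [hval]
    split_ifs with h
    · simp [h]
    · simp only [h, false_iff]
      intro h'
      linarith

theorem affineSpan_convexHull_image_insert {ι κ E : Type*} [Fintype κ] [DecidableEq ι]
    [AddCommGroup E] [Module ℝ E] (p : ι → E) (s : ι) (e : κ → ι) :
    affineSpan ℝ (convexHull ℝ (p '' (insert s (Finset.univ.image e) : Finset ι)))
      = AffineSubspace.mk' (p s) (Submodule.span ℝ (Set.range fun i => p (e i) - p s)) := by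
  rw [affineSpan_convexHull]
  have hs : p s ∈ affineSpan ℝ (p '' (insert s (Finset.univ.image e) : Finset ι)) :=
    subset_affineSpan ℝ _ ⟨s, by simp, rfl⟩
  apply le_antisymm
  · rw [affineSpan_le]
    rintro _ ⟨i, hi, rfl⟩
    rw [SetLike.mem_coe, AffineSubspace.mem_mk', vsub_eq_sub]
    rcases Finset.mem_insert.1 hi with rfl | hi
    · simp
    · obtain ⟨k, -, rfl⟩ := Finset.mem_image.1 hi
      exact Submodule.subset_span ⟨k, rfl⟩
  · intro x hx
    rw [AffineSubspace.mem_mk', vsub_eq_sub] at hx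
    have hW : Submodule.span ℝ (Set.range fun i => p (e i) - p s)
        ≤ (affineSpan ℝ (p '' (insert s (Finset.univ.image e) : Finset ι))).direction := by
      rw [Submodule.span_le]
      rintro _ ⟨k, rfl⟩
      exact AffineSubspace.vsub_mem_direction (subset_affineSpan ℝ _ ⟨e k, by simp, rfl⟩) hs
    simpa using AffineSubspace.vadd_mem_of_mem_direction (hW hx) hs

theorem linearIndependent_sub_of_affineIndependent {ι κ E : Type*} [AddCommGroup E] [Module ℝ E]
    {p : ι → E} (hind : AffineIndependent ℝ p) {s : ι} {e : κ → ι} (he : Function.Injective e)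
    (hs : s ∉ Set.range e) : LinearIndependent ℝ fun i => p (e i) - p s :=
  ((affineIndependent_iff_linearIndependent_vsub ℝ p s).1 hind).comp
    (fun i => ⟨e i, fun h => hs ⟨i, h⟩⟩) fun _ _ h => he (congrArg Subtype.val h)

theorem mem_span_int_basis_iff {κ E : Type*} [Fintype κ] [AddCommGroup E] [Module ℝ E]
    (b : Module.Basis κ ℝ E) (x : E) :
    x ∈ Submodule.span ℤ (Set.range b) ↔ ∃ z : κ → ℤ, b.equivFun x = latt z := by
  rw [b.mem_span_iff_repr_mem ℤ]
  constructor
  · intro h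
    choose z hz using h
    exact ⟨z, funext fun i => (hz i).symm⟩
  · rintro ⟨z, hz⟩ i
    exact ⟨z i, (congrFun hz i).symm⟩

/-- A rational subspace, translated by a lattice point, has a unimodular parametrization. -/
theorem exists_isUnimodularParam {n j : ℕ} (F : Set (Fin n → ℝ)) (a : Fin n → ℤ)
    (u : Fin j → Fin n → ℤ) (hu : LinearIndependent ℝ fun i => latt (u i))
    (hF : affineSpan ℝ F
      = AffineSubspace.mk' (latt a) (Submodule.span ℝ (Set.range fun i => latt (u i)))) :
    ∃ φ : (Fin j → ℝ) →ᵃ[ℝ] (Fin n → ℝ), IsUnimodularParam F φ := by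
  set W := Submodule.span ℝ (Set.range fun i => latt (u i)) with hW
  have hWrank : Module.finrank ℝ W = j := by
    rw [hW, finrank_span_eq_card hu, Fintype.card_fin]
  let L₀ := Submodule.span ℤ (Set.range (Pi.basisFun ℝ (Fin n)))
  have hL₀ : ∀ x, x ∈ L₀ ↔ ∃ z : Fin n → ℤ, x = latt z := fun x =>
    mem_span_int_basis_iff (Pi.basisFun ℝ (Fin n)) x
  let L : Submodule ℤ W := ZLattice.comap ℝ L₀ W.subtype
  have hL : ∀ x : W, x ∈ L ↔ ∃ z : Fin n → ℤ, (x : Fin n → ℝ) = latt z := fun x => hL₀ x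
  have : DiscreteTopology L :=
    ZLattice.comap_discreteTopology ℝ L₀ continuous_subtype_val Subtype.val_injective
  have : IsZLattice ℝ L := by
    refine ⟨?_⟩
    rw [eq_top_iff, ← Submodule.map_le_map_iff_of_injective W.injective_subtype,
      Submodule.map_subtype_top, Submodule.map_span]
    refine Submodule.span_mono ?_
    rintro _ ⟨i, rfl⟩
    exact ⟨⟨latt (u i), Submodule.subset_span ⟨i, rfl⟩⟩, (hL _).2 ⟨u i, rfl⟩, rfl⟩
  have : Module.Finite ℤ L := ZLattice.module_finite ℝ L
  have : Module.Free ℤ L := ZLattice.module_free ℝ L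
  have hLrank : Module.finrank ℤ L = j := (ZLattice.rank ℝ L).trans hWrank
  let c : Module.Basis (Fin j) ℝ W := (Module.finBasisOfFinrankEq ℤ L hLrank).ofZLatticeBasis ℝ L
  have hc : Submodule.span ℤ (Set.range c) = L := Module.Basis.ofZLatticeBasis_span ℝ L _
  let φ : (Fin j → ℝ) →ᵃ[ℝ] (Fin n → ℝ) :=
    (W.subtype ∘ₗ c.equivFun.symm.toLinearMap).toAffineMap + AffineMap.const ℝ _ (latt a)
  have hφ : ∀ x, φ x = (c.equivFun.symm x : W) + latt a := fun x => rfl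
  refine ⟨φ, fun x y h => ?_, ?_, fun x => ?_⟩
  · rw [hφ, hφ] at h
    exact c.equivFun.symm.injective (Subtype.val_injective (add_right_cancel h))
  · rw [hF]
    ext y
    rw [SetLike.mem_coe, AffineSubspace.mem_mk', vsub_eq_sub]
    constructor
    · rintro ⟨x, rfl⟩
      rw [hφ, add_sub_cancel_right]
      exact (c.equivFun.symm x).2
    · intro hy
      exact ⟨c.equivFun ⟨y - latt a, hy⟩, by rw [hφ, LinearEquiv.symm_apply_apply, sub_add_cancel]⟩
  · have h1 := mem_span_int_basis_iff c (c.equivFun.symm x)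
    rw [hc, hL, LinearEquiv.apply_symm_apply] at h1
    rw [← h1, hφ]
    constructor
    · rintro ⟨z, hz⟩
      exact ⟨z + a, by rw [hz, latt_add]⟩
    · rintro ⟨z, hz⟩
      exact ⟨z - a, by rw [latt_sub, ← hz, add_sub_cancel_right]⟩

theorem volume_image_cornerSimplex {k : ℕ} (A : Matrix (Fin k) (Fin k) ℤ) (w : Fin k → ℝ) :
    k.factorial * (volume ((fun x => w + (A.map (Int.cast : ℤ → ℝ)).mulVec x) ''
      cornerSimplex k 1)).toReal = A.det.natAbs := by
  set B := A.map (Int.cast : ℤ → ℝ)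
  have hB : LinearMap.det B.toLin' = (A.det : ℝ) := by
    rw [LinearMap.det_toLin']
    exact ((Int.castRingHom ℝ).map_det A).symm
  have himage : (fun x => w + B.mulVec x) '' cornerSimplex k 1
      = (fun x => w + x) '' (B.toLin' '' cornerSimplex k 1) := by
    rw [Set.image_image]
    rfl
  rw [himage, Set.image_add_left, measure_preimage_add, Measure.addHaar_image_linearMap, hB,
    volume_cornerSimplex k zero_le_one, ENNReal.toReal_mul, ENNReal.toReal_ofReal (abs_nonneg _),
    ENNReal.toReal_ofReal (by positivity), one_pow, Nat.cast_natAbs, Int.cast_abs]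
  have : (k.factorial : ℝ) ≠ 0 := by positivity
  field_simp

theorem sum_eq_add_sum_of_forall_notMem {ι κ E : Type*} [Fintype ι] [Fintype κ] [DecidableEq ι]
    [AddCommMonoid E] {s : ι} {e : κ → ι} (he : Function.Injective e) (hs : s ∉ Set.range e)
    (g : ι → E) (hg : ∀ i ∉ insert s (Finset.univ.image e), g i = 0) :
    ∑ i, g i = g s + ∑ k, g (e k) := by
  rw [← Finset.sum_subset (Finset.subset_univ (insert s (Finset.univ.image e))) fun i _ => hg i,
    Finset.sum_insert (by simpa using hs), Finset.sum_image fun _ _ _ _ h => he h]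

/-- The function with value `a` at `s`, value `x k` at `e k`, and zero elsewhere. -/
def extendAt {ι κ : Type*} [DecidableEq ι] (s : ι) (e : κ → ι) (a : ℝ) (x : κ → ℝ) : ι → ℝ :=
  Function.update (Function.extend e x 0) s a

section extendAt

variable {ι κ : Type*} [DecidableEq ι] {s : ι} {e : κ → ι} (a : ℝ) (x : κ → ℝ)

theorem extendAt_self : extendAt s e a x s = a := Function.update_self ..

theorem extendAt_apply (he : Function.Injective e) (hs : s ∉ Set.range e) (k : κ) :
    extendAt s e a x (e k) = x k := by
  rw [extendAt, Function.update_of_ne fun h => hs ⟨k, h⟩, he.extend_apply]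

theorem extendAt_of_notMem [Fintype κ] {i : ι} (hi : i ∉ insert s (Finset.univ.image e)) :
    extendAt s e a x i = 0 := by
  simp only [Finset.mem_insert, Finset.mem_image, Finset.mem_univ, true_and, not_or] at hi
  rw [extendAt, Function.update_of_ne hi.1, Function.extend_apply' _ _ _ hi.2, Pi.zero_apply]

theorem extendAt_mem [Fintype κ] (he : Function.Injective e) (hs : s ∉ Set.range e) {t : Set ℝ}
    (h0 : (0 : ℝ) ∈ t) (ha : a ∈ t) (hx : ∀ k, x k ∈ t) (i : ι) : extendAt s e a x i ∈ t := by
  by_cases hi : i ∈ insert s (Finset.univ.image e)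
  · rcases Finset.mem_insert.1 hi with rfl | hi
    · rwa [extendAt_self]
    · obtain ⟨k, -, rfl⟩ := Finset.mem_image.1 hi
      rw [extendAt_apply _ _ he hs]
      exact hx k
  · rwa [extendAt_of_notMem _ _ hi]

end extendAt

/-- A simplex is the image of the corner simplex under the parametrization by edge vectors. -/
theorem convexHull_eq_image_cornerSimplex {ι E : Type*} {j : ℕ} [Fintype ι] [DecidableEq ι]
    [AddCommGroup E] [Module ℝ E] (p : ι → E) {s : ι} {e : Fin j → ι}
    (he : Function.Injective e) (hs : s ∉ Set.range e) :
    convexHull ℝ (p '' (insert s (Finset.univ.image e) : Finset ι))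
      = (fun x : Fin j → ℝ => p s + ∑ k, x k • (p (e k) - p s)) '' cornerSimplex j 1 := by
  have hcomb : ∀ (a : ℝ) (x : Fin j → ℝ), a + ∑ k, x k = 1 →
      a • p s + ∑ k, x k • p (e k) = p s + ∑ k, x k • (p (e k) - p s) := by
    intro a x h
    simp only [smul_sub, Finset.sum_sub_distrib, ← Finset.sum_smul]
    rw [show a = 1 - ∑ k, x k by linarith, sub_smul, one_smul]
    abel
  ext y
  rw [mem_convexHull_image_iff_exists_weights]
  constructor
  · rintro ⟨c, hc0, hc1, hcS, rfl⟩
    rw [sum_eq_add_sum_of_forall_notMem he hs c hcS] at hc1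
    refine ⟨fun k => c (e k), ⟨fun k => hc0 _, by linarith [hc0 s]⟩, ?_⟩
    rw [sum_eq_add_sum_of_forall_notMem he hs _ fun i hi => by rw [hcS i hi, zero_smul]]
    exact (hcomb _ _ hc1).symm
  · rintro ⟨x, ⟨hx0, hx1⟩, rfl⟩
    have h0 : ∀ i ∉ insert s (Finset.univ.image e), extendAt s e (1 - ∑ k, x k) x i = 0 :=
      fun i hi => extendAt_of_notMem _ _ hi
    refine ⟨extendAt s e (1 - ∑ k, x k) x,
      extendAt_mem _ _ he hs (t := Set.Ici 0) Set.self_mem_Ici (sub_nonneg.2 hx1) hx0, ?_, h0, ?_⟩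
    · rw [sum_eq_add_sum_of_forall_notMem he hs _ h0]
      simp only [extendAt_self, extendAt_apply _ _ he hs]
      ring
    · rw [sum_eq_add_sum_of_forall_notMem he hs _ fun i hi => by rw [h0 i hi, zero_smul]]
      simp only [extendAt_self, extendAt_apply _ _ he hs]
      exact (hcomb _ _ (by ring)).symm

/-- The coefficient vectors in the half-open unit cube, supported in `S`, of the lattice points
in the cone over the lattice simplex with vertices `v`. -/
def latticeBox {ι : Type*} [Fintype ι] {n : ℕ} (v : ι → Fin n → ℤ) (S : Finset ι) :
    Set (ι → ℝ) :=
  {c | (∀ i, c i ∈ Set.Ico (0 : ℝ) 1) ∧ (∀ i ∉ S, c i = 0) ∧ (∃ k : ℤ, ∑ i, c i = k) ∧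
    ∃ z : Fin n → ℤ, ∑ i, c i • latt (v i) = latt z}

/-- If the combinations of the columns of `A` and of the edge vectors at `v s` with the same
coefficients are simultaneously integral, restriction of coefficients identifies the box of a face
with the preimage of the lattice in the unit cube. -/
theorem bijOn_latticeBox_cubePreimage {ι : Type*} [Fintype ι] [DecidableEq ι] {n j : ℕ}
    (v : ι → Fin n → ℤ) {s : ι} {e : Fin j → ι} (he : Function.Injective e)
    (hs : s ∉ Set.range e) (A : Matrix (Fin j) (Fin j) ℤ)
    (hA : ∀ x : Fin j → ℝ, (∃ w, (A.map (Int.cast : ℤ → ℝ)).mulVec x = latt w) ↔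
      ∃ z, ∑ k, x k • (latt (v (e k)) - latt (v s)) = latt z) :
    Set.BijOn (fun c k => c (e k)) (latticeBox v (insert s (Finset.univ.image e)))
      (cubePreimage A) := by
  have hcomb : ∀ (a : ℝ) (x : Fin j → ℝ),
      a • latt (v s) + ∑ k, x k • latt (v (e k))
        = (a + ∑ k, x k) • latt (v s) + ∑ k, x k • (latt (v (e k)) - latt (v s)) := by
    intro a x
    simp only [smul_sub, Finset.sum_sub_distrib, ← Finset.sum_smul, add_smul]
    abel
  refine ⟨?_, ?_, ?_⟩
  · rintro c ⟨hc, hcS, ⟨m, hm⟩, z, hz⟩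
    refine ⟨fun k => hc _, (hA _).2 ⟨z - m • v s, ?_⟩⟩
    rw [sum_eq_add_sum_of_forall_notMem he hs c hcS] at hm
    rw [sum_eq_add_sum_of_forall_notMem he hs _ fun i hi => by rw [hcS i hi, zero_smul],
      hcomb, hm] at hz
    rw [latt_sub, latt_zsmul, ← hz, add_sub_cancel_left]
  · rintro c ⟨hc, hcS, ⟨m, hm⟩, -⟩ d ⟨hd, hdS, ⟨l, hl⟩, -⟩ h
    have hk : ∀ k, c (e k) = d (e k) := fun k => congrFun h k
    rw [sum_eq_add_sum_of_forall_notMem he hs _ hcS] at hm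
    rw [sum_eq_add_sum_of_forall_notMem he hs _ hdS] at hl
    have hcs := hc s
    have hds := hd s
    have hdiff : c s - d s = (m - l : ℤ) := by
      simp only [hk] at hm
      push_cast
      linarith
    have hzero : m - l = 0 := by
      have h1 : ((m - l : ℤ) : ℝ) < 1 := by linarith [hcs.2, hds.1]
      have h2 : (-1 : ℝ) < (m - l : ℤ) := by linarith [hcs.1, hds.2]
      have h1' : m - l < 1 := by exact_mod_cast h1
      have h2' : -1 < m - l := by exact_mod_cast h2
      omega
    rw [hzero, Int.cast_zero] at hdiff
    ext i
    by_cases hi : i ∈ insert s (Finset.univ.image e)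
    · rcases Finset.mem_insert.1 hi with rfl | hi
      · linarith
      · obtain ⟨k, -, rfl⟩ := Finset.mem_image.1 hi
        exact hk k
    · rw [hcS i hi, hdS i hi]
  · rintro x ⟨hx, hw⟩
    obtain ⟨z, hz⟩ := (hA x).1 hw
    set a := Int.fract (-∑ k, x k) with ha
    have h0 : ∀ i ∉ insert s (Finset.univ.image e), extendAt s e a x i = 0 :=
      fun i hi => extendAt_of_notMem _ _ hi
    have hsum : a + ∑ k, x k = (-⌊-∑ k, x k⌋ : ℤ) := by
      rw [ha, Int.fract]
      push_cast
      ring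
    refine ⟨extendAt s e a x, ⟨extendAt_mem _ _ he hs ⟨le_rfl, zero_lt_one⟩
      ⟨Int.fract_nonneg _, Int.fract_lt_one _⟩ hx, h0,
        ⟨-⌊-∑ k, x k⌋, ?_⟩, ⟨-⌊-∑ k, x k⌋ • v s + z, ?_⟩⟩,
      funext fun k => extendAt_apply _ _ he hs k⟩
    · rw [sum_eq_add_sum_of_forall_notMem he hs _ h0]
      simp only [extendAt_self, extendAt_apply _ _ he hs]
      exact hsum
    · rw [sum_eq_add_sum_of_forall_notMem he hs _ fun i hi => by rw [h0 i hi, zero_smul]]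
      simp only [extendAt_self, extendAt_apply _ _ he hs]
      rw [hcomb, hsum, hz, latt_add, latt_zsmul]

/-- The normalized volume of a lattice simplex counts the points of its box. -/
theorem factorial_mul_volume_eq_ncard_latticeBox {ι : Type*} [Fintype ι] [DecidableEq ι] {n j : ℕ}
    (v : ι → Fin n → ℤ) (hind : AffineIndependent ℝ fun i => latt (v i)) {s : ι} {e : Fin j → ι}
    (he : Function.Injective e) (hs : s ∉ Set.range e) (F : Set (Fin n → ℝ))
    (hF : F = convexHull ℝ ((fun i => latt (v i)) '' (insert s (Finset.univ.image e) : Finset ι)))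
    (φ : (Fin j → ℝ) →ᵃ[ℝ] (Fin n → ℝ)) (hφ : IsUnimodularParam F φ) :
    (latticeBox v (insert s (Finset.univ.image e))).Finite ∧
      j.factorial * (volume (φ ⁻¹' F)).toReal
        = (latticeBox v (insert s (Finset.univ.image e))).ncard := by
  obtain ⟨hφinj, hφrange, hφlatt⟩ := hφ
  have hvertex : ∀ i ∈ insert s (Finset.univ.image e), ∃ w, φ (latt w) = latt (v i) := by
    intro i hi
    have hmem : latt (v i) ∈ Set.range φ := by
      rw [hφrange, hF, affineSpan_convexHull]
      exact subset_affineSpan ℝ _ ⟨i, hi, rfl⟩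
    obtain ⟨x, hx⟩ := hmem
    obtain ⟨w, rfl⟩ := (hφlatt x).2 ⟨_, hx⟩
    exact ⟨w, hx⟩
  obtain ⟨w₀, hw₀⟩ := hvertex s (Finset.mem_insert_self _ _)
  choose w hw using fun k => hvertex (e k) (by simp)
  let A : Matrix (Fin j) (Fin j) ℤ := Matrix.of fun a k => (w k - w₀) a
  set B := A.map (Int.cast : ℤ → ℝ) with hB
  have hBx : ∀ x, B.mulVec x = ∑ k, x k • (latt (w k) - latt w₀) := by
    intro x
    ext a
    simp [hB, A, Matrix.mulVec, dotProduct, latt, mul_comm]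
  have hφB : ∀ x, φ (latt w₀ + B.mulVec x)
      = latt (v s) + ∑ k, x k • (latt (v (e k)) - latt (v s)) := by
    intro x
    have h1 := φ.map_vadd (latt w₀) (B.mulVec x)
    rw [vadd_eq_add, vadd_eq_add, add_comm] at h1
    rw [h1, hw₀, add_comm, hBx, map_sum]
    congr 1
    refine Finset.sum_congr rfl fun k _ => ?_
    have h2 := φ.linearMap_vsub (latt (w k)) (latt w₀)
    rw [vsub_eq_sub, vsub_eq_sub, hw, hw₀] at h2
    rw [map_smul, h2]
  have hdet : A.det ≠ 0 := by
    intro h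
    have hBdet : B.det = 0 := by
      rw [hB, show (A.map (Int.cast : ℤ → ℝ)).det = (A.det : ℝ) from
        ((Int.castRingHom ℝ).map_det A).symm, h, Int.cast_zero]
    obtain ⟨x, hx, hx0⟩ := Matrix.exists_mulVec_eq_zero_iff.2 hBdet
    have h1 := hφB x
    rw [hx0, add_zero, hw₀, left_eq_add] at h1
    exact hx (funext (Fintype.linearIndependent_iff.1
      (linearIndependent_sub_of_affineIndependent hind he hs) x h1))
  have hpre : φ ⁻¹' F = (fun x => latt w₀ + B.mulVec x) '' cornerSimplex j 1 := by
    rw [hF, convexHull_eq_image_cornerSimplex _ he hs, ← Set.preimage_image_eq (_ '' _) hφinj,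
      Set.image_image]
    simp only [hφB]
  have hbij := bijOn_latticeBox_cubePreimage v he hs A (by
    intro x
    constructor
    · rintro ⟨y, hy⟩
      obtain ⟨z, hz⟩ := (hφlatt (latt (w₀ + y))).1 ⟨_, rfl⟩
      rw [latt_add, ← hy, hφB] at hz
      exact ⟨z - v s, by rw [latt_sub, ← hz, add_sub_cancel_left]⟩
    · rintro ⟨z, hz⟩
      obtain ⟨y, hy⟩ := (hφlatt (latt w₀ + B.mulVec x)).2 ⟨v s + z, by rw [hφB, hz, latt_add]⟩
      exact ⟨y - w₀, by rw [latt_sub, ← hy, add_sub_cancel_left]⟩)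
  obtain ⟨hfin, hcard⟩ := finite_cubePreimage_and_ncard A hdet
  refine ⟨hbij.finite_iff_finite.2 hfin, ?_⟩
  rw [hpre, volume_image_cornerSimplex, ← hcard, ← hbij.image_eq,
    hbij.injOn.ncard_image]

theorem exists_eq_insert_image_of_card_eq_succ {ι : Type*} [LinearOrder ι] {S : Finset ι} {j : ℕ}
    (hS : S.card = j + 1) :
    ∃ (s : ι) (e : Fin j → ι), Function.Injective e ∧ s ∉ Set.range e ∧
      S = insert s (Finset.univ.image e) := by
  obtain ⟨s, hs⟩ := Finset.card_pos.1 (by omega : 0 < S.card)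
  have hcard : (S.erase s).card = j := by rw [Finset.card_erase_of_mem hs, hS, Nat.add_sub_cancel]
  refine ⟨s, (S.erase s).orderEmbOfFin hcard, ((S.erase s).orderEmbOfFin hcard).injective, ?_, ?_⟩
  · rw [Finset.range_orderEmbOfFin]
    simp
  · rw [Finset.image_orderEmbOfFin_univ, Finset.insert_erase hs]

theorem finrank_direction_affineSpan_convexHull_image {ι E : Type*} [LinearOrder ι]
    [AddCommGroup E] [Module ℝ E] {p : ι → E} (hind : AffineIndependent ℝ p) {S : Finset ι} {j : ℕ}
    (hS : S.card = j + 1) :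
    Module.finrank ℝ (affineSpan ℝ (convexHull ℝ (p '' S))).direction = j := by
  obtain ⟨s, e, he, hs, rfl⟩ := exists_eq_insert_image_of_card_eq_succ hS
  rw [affineSpan_convexHull_image_insert, AffineSubspace.direction_mk',
    finrank_span_eq_card (linearIndependent_sub_of_affineIndependent hind he hs), Fintype.card_fin]

theorem injective_convexHull_image_of_affineIndependent {ι E : Type*}
    [AddCommGroup E] [Module ℝ E] {p : ι → E} (hind : AffineIndependent ℝ p) :
    Function.Injective fun S : Finset ι => convexHull ℝ (p '' (S : Set ι)) := by
  have hsub : ∀ S T : Finset ι, convexHull ℝ (p '' (S : Set ι)) = convexHull ℝ (p '' (T : Set ι)) →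
      S ⊆ T := by
    intro S T h i hi
    have hmem : p i ∈ convexHull ℝ (p '' (T : Set ι)) := h ▸ subset_convexHull ℝ _ ⟨i, hi, rfl⟩
    exact (hind.mem_affineSpan_iff i _).1 (convexHull_subset_affineSpan _ hmem)
  exact fun S T h => (hsub S T h).antisymm (hsub T S h.symm)

/-- The `j`-dimensional faces of a full-dimensional simplex are the convex hulls of the sets of
`j + 1` vertices. -/
theorem setOf_isFaceOfDim_simplex {ι : Type*} [Fintype ι] [LinearOrder ι] {n : ℕ}
    {p : ι → Fin n → ℝ} (hind : AffineIndependent ℝ p) (htop : affineSpan ℝ (Set.range p) = ⊤)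
    (j : ℕ) :
    {F | IsFaceOfDim (convexHull ℝ (Set.range p)) F j}
      = (fun S : Finset ι => convexHull ℝ (p '' (S : Set ι))) ''
        (Finset.powersetCard (j + 1) Finset.univ : Finset (Finset ι)) := by
  ext F
  constructor
  · rintro ⟨hne, hexp, hdim⟩
    obtain ⟨l, hl⟩ := hexp hne
    have hne' : (Finset.univ : Finset ι).Nonempty := by
      obtain ⟨x, hx⟩ := hne
      rw [hl] at hx
      obtain ⟨_, ⟨i, rfl⟩⟩ := convexHull_nonempty_iff.1 ⟨x, hx.1⟩
      exact ⟨i, Finset.mem_univ i⟩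
    obtain ⟨m, -, hm⟩ := Finset.exists_max_image Finset.univ (fun i => l (p i)) hne'
    let S : Finset ι := {i | l (p i) = l (p m)}
    have hSne : S.Nonempty := ⟨m, by simp [S]⟩
    have hF : F = convexHull ℝ (p '' (S : Set ι)) := by
      rw [hl, ← setOf_isMax_convexHull_range p l.toLinearMap (l (p m)) S hSne
        (fun i => hm i (Finset.mem_univ i)) fun i => by simp [S]]
      rfl
    obtain ⟨k, hk⟩ : ∃ k, S.card = k + 1 := ⟨S.card - 1, by have := hSne.card_pos; omega⟩
    have hkj : k = j := by
      rw [← finrank_direction_affineSpan_convexHull_image hind hk, ← hF, hdim]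
    exact ⟨S, Finset.mem_coe.2 (Finset.mem_powersetCard_univ.2 (hkj ▸ hk)), hF.symm⟩
  · rintro ⟨S, hS, rfl⟩
    have hcard : S.card = j + 1 := Finset.mem_powersetCard_univ.1 (Finset.mem_coe.1 hS)
    have hSne : S.Nonempty := Finset.card_pos.1 (by omega)
    refine ⟨?_, fun _ => ?_, finrank_direction_affineSpan_convexHull_image hind hcard⟩
    · exact convexHull_nonempty_iff.2 (hSne.to_set.image p)
    · obtain ⟨l, M, hle, hiff⟩ := exists_linearMap_max_on_finset hind htop S
      exact ⟨l.toContinuousLinearMap, (setOf_isMax_convexHull_range p l M S hSne hle hiff).symm⟩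

/-- For an `n`-dimensional lattice simplex `P ⊂ ℝ^n` one has
`c(P) = ∑_{j=0}^n (-1)^{n-j} (j+1) ∑_{F ∈ F(P)_j} Vol_ℤ(F) ≥ 0`, where `Vol_ℤ(F)` is
the normalized volume of the `j`-dimensional face `F` (i.e. `j!` times the Lebesgue
volume of `F` pulled back along any unimodular parametrization of `aff F`). -/
theorem simplex_c_nonneg {n : ℕ} (v : Fin (n + 1) → Fin n → ℤ)
    (hind : AffineIndependent ℝ (fun i => latt (v i)))
    (P : Set (Fin n → ℝ)) (hP : P = convexHull ℝ (Set.range (fun i => latt (v i))))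
    (hfull : affineSpan ℝ P = ⊤)
    (VolZ : ℕ → Set (Fin n → ℝ) → ℝ)
    (hVolZ : ∀ (j : ℕ) (F : Set (Fin n → ℝ)), IsFaceOfDim P F j →
      ∀ φ : (Fin j → ℝ) →ᵃ[ℝ] (Fin n → ℝ), IsUnimodularParam F φ →
        VolZ j F = (Nat.factorial j : ℝ) * (volume (φ ⁻¹' F)).toReal) :
    0 ≤ ∑ j ∈ Finset.range (n + 1),
        (-1 : ℝ) ^ (n - j) * (j + 1) * ∑ᶠ F ∈ {F | IsFaceOfDim P F j}, VolZ j F := by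
  set p : Fin (n + 1) → Fin n → ℝ := fun i => latt (v i) with hp
  have htop : affineSpan ℝ (Set.range p) = ⊤ := by rw [← hfull, hP, affineSpan_convexHull]
  have hface : ∀ j (S : Finset (Fin (n + 1))), S.card = j + 1 → (latticeBox v S).Finite ∧
      VolZ j (convexHull ℝ (p '' (S : Set (Fin (n + 1))))) = (latticeBox v S).ncard := by
    intro j S hS
    have hFS : IsFaceOfDim P (convexHull ℝ (p '' (S : Set (Fin (n + 1))))) j := by
      have := (setOf_isFaceOfDim_simplex hind htop j).ge
        ⟨S, Finset.mem_coe.2 (Finset.mem_powersetCard_univ.2 hS), rfl⟩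
      rwa [← hP] at this
    obtain ⟨s, e, he, hs, rfl⟩ := exists_eq_insert_image_of_card_eq_succ hS
    obtain ⟨φ, hφ⟩ := exists_isUnimodularParam _ (v s) (fun k => v (e k) - v s)
      (by simpa only [latt_sub] using linearIndependent_sub_of_affineIndependent hind he hs)
      (by simpa only [latt_sub] using affineSpan_convexHull_image_insert p s e)
    rw [hVolZ j _ hFS φ hφ]
    exact factorial_mul_volume_eq_ncard_latticeBox v hind he hs _ rfl φ hφ
  have hfin : (latticeBox v Finset.univ).Finite := (hface n Finset.univ (by simp)).1
  let supp : (Fin (n + 1) → ℝ) → Finset (Fin (n + 1)) := fun c => {i | c i ≠ 0}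
  have hbox : ∀ S : Finset (Fin (n + 1)),
      (latticeBox v S).ncard = (hfin.toFinset.filter fun c => supp c ⊆ S).card := by
    intro S
    rw [← Set.ncard_coe_finset]
    congr 1
    ext c
    have hsupp : supp c ⊆ S ↔ ∀ i ∉ S, c i = 0 := by
      simp only [supp, Finset.subset_iff, Finset.mem_filter, Finset.mem_univ, true_and]
      exact forall_congr' fun i => not_imp_comm
    simp only [latticeBox, Finset.coe_filter, Set.Finite.mem_toFinset, Set.mem_ofPred_eq, hsupp,
      Finset.mem_univ, not_true_eq_false, false_implies, implies_true, true_and]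
    tauto
  have hsum : ∀ j, ∑ᶠ F ∈ {F | IsFaceOfDim P F j}, VolZ j F
      = ∑ S ∈ Finset.powersetCard (j + 1) Finset.univ,
        ((hfin.toFinset.filter fun c => supp c ⊆ S).card : ℝ) := by
    intro j
    rw [hP, setOf_isFaceOfDim_simplex hind htop j,
      finsum_mem_image (injective_convexHull_image_of_affineIndependent hind).injOn,
      finsum_mem_coe_finset]
    refine Finset.sum_congr rfl fun S hS => ?_
    rw [(hface j S (Finset.mem_powersetCard_univ.1 hS)).2, hbox]
  simp only [hsum]
  exact alternating_sum_card_filter_support_nonneg hfin.toFinset supp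
end
end
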